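/- arXiv:1408.1886 — 4 statements merged into one kernel-verified Lean document; each statement's English description precedes it below -/
import Mathlib

section
/- For every real x with |x| < 1, setting D(x) = 3·cos x + 4 − cosh(√3·x) (which is positive for |x| < 1), the following hold, where all series converge absolutely: D(x)·Σ_{n odd} f(n)·xⁿ/n! = √3·sinh(√3·x) + 3·sin x; D(x)·Σ_{n even} f(n)·xⁿ/n! = 2√3·sin(x/2)·sinh(√3·x/2) + 6·cos(x/2)·cosh(√3·x/2); D(x)·Σ_{n odd} g(n)·xⁿ/n! = 4√3·cos(x/2)·sinh(√3·x/2); D(x)·Σ_{n even} g(n)·xⁿ/n! = 6·cos(x/2)·cosh(√3·x/2) + 2√3·sin(x/2)·sinh(√3·x/2) + 2 − 2·cosh(√3·x). -/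
/-- The entry of the permutation `σ` of `[n]` at (1-based) position `i`,
as a value in `{1, …, n}`; `0` if `i` is out of range. -/
def permEnt {n : ℕ} (σ : Equiv.Perm (Fin n)) (i : ℕ) : ℕ :=
  if h : 1 ≤ i ∧ i ≤ n then (σ ⟨i - 1, by omega⟩ : ℕ) + 1 else 0

/-- `i` is a descent of `σ`: `1 ≤ i ≤ n−1` and `π_i > π_{i+1}`. -/
def IsDescent {n : ℕ} (σ : Equiv.Perm (Fin n)) (i : ℕ) : Prop :=
  1 ≤ i ∧ i < n ∧ permEnt σ (i + 1) < permEnt σ i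

/-- `i` is an alternating descent of `σ`: `i` odd with `π_i > π_{i+1}`,
or `i` even with `π_i < π_{i+1}`. -/
def IsAltDescent {n : ℕ} (σ : Equiv.Perm (Fin n)) (i : ℕ) : Prop :=
  1 ≤ i ∧ i < n ∧
    ((i % 2 = 1 ∧ permEnt σ (i + 1) < permEnt σ i) ∨
     (i % 2 = 0 ∧ permEnt σ i < permEnt σ (i + 1)))

instance {n : ℕ} (σ : Equiv.Perm (Fin n)) (i : ℕ) : Decidable (IsDescent σ i) := by
  unfold IsDescent; infer_instance

instance {n : ℕ} (σ : Equiv.Perm (Fin n)) (i : ℕ) : Decidable (IsAltDescent σ i) := by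
  unfold IsAltDescent; infer_instance

/-- `i` is a peak of `σ`: `2 ≤ i ≤ n−1` and `π_{i−1} < π_i > π_{i+1}`. -/
def IsPeak {n : ℕ} (σ : Equiv.Perm (Fin n)) (i : ℕ) : Prop :=
  2 ≤ i ∧ i < n ∧ permEnt σ (i - 1) < permEnt σ i ∧ permEnt σ (i + 1) < permEnt σ i

/-- `i` is a valley of `σ`: `2 ≤ i ≤ n−1` and `π_{i−1} > π_i < π_{i+1}`. -/
def IsValley {n : ℕ} (σ : Equiv.Perm (Fin n)) (i : ℕ) : Prop :=
  2 ≤ i ∧ i < n ∧ permEnt σ i < permEnt σ (i - 1) ∧ permEnt σ i < permEnt σ (i + 1)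

/-- All valleys of `σ` are even and all peaks of `σ` are odd. -/
def GoodPerm {n : ℕ} (σ : Equiv.Perm (Fin n)) : Prop :=
  (∀ i, IsValley σ i → i % 2 = 0) ∧ (∀ i, IsPeak σ i → i % 2 = 1)

/-- `f n` is the number of permutations of `[n]` with all valleys even and all peaks odd. -/
noncomputable def fCount (n : ℕ) : ℕ :=
  Nat.card {σ : Equiv.Perm (Fin n) // GoodPerm σ}

/-- `g n` is the number of permutations of `[n]` with all valleys even and all peaks odd
having no descent at position `n − 1`. -/
noncomputable def gCount (n : ℕ) : ℕ :=
  Nat.card {σ : Equiv.Perm (Fin n) // GoodPerm σ ∧ ¬ IsDescent σ (n - 1)}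

/-- `σ` is an alternating permutation: `π₁ > π₂ < π₃ > π₄ < ⋯`. -/
def IsAltPerm {n : ℕ} (σ : Equiv.Perm (Fin n)) : Prop :=
  ∀ i, 1 ≤ i → i < n →
    (i % 2 = 1 → permEnt σ (i + 1) < permEnt σ i) ∧
    (i % 2 = 0 → permEnt σ i < permEnt σ (i + 1))

/-- The Euler number `Eₙ`, the number of alternating permutations of `[n]`. -/
noncomputable def eulerNum (n : ℕ) : ℕ :=
  Nat.card {σ : Equiv.Perm (Fin n) // IsAltPerm σ}

namespace S5

def Good {α : Type*} [LinearOrder α] : Bool → List α → Prop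
  | true, x :: y :: z :: t => ¬ (x < y ∧ z < y) ∧ Good false (y :: z :: t)
  | false, x :: y :: z :: t => ¬ (y < x ∧ y < z) ∧ Good true (y :: z :: t)
  | _, _ => True

def EndDesc {α : Type*} [LinearOrder α] : List α → Prop
  | _ :: y :: z :: t => EndDesc (y :: z :: t)
  | [x, y] => y < x
  | _ => False

section
variable {α β : Type*} [LinearOrder α] [LinearOrder β]

lemma good_cons_max (m : α) (l : List α) (h : ∀ y ∈ l, y < m) :
    Good true (m :: l) ↔ Good false l := by
  match l with
  | [] => simp [Good]
  | [a] => simp [Good]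
  | a :: b :: t =>
    have : a < m := h a (by simp)
    simp [Good, not_lt.2 this.le]

lemma good_even (m : α) (r : List α) (hr : ∀ y ∈ r, y < m) :
    ∀ (b : Bool) (l : List α), (∀ y ∈ l, y < m) → (l.length % 2 = if b then 0 else 1) →
    (Good b (l ++ m :: r) ↔ Good b l ∧ Good false r)
  | true, [], _, _ => by simp [good_cons_max m r hr, Good]
  | false, [], _, h => by simp at h
  | true, [a], _, h => by simp at h
  | false, [a], hl, h => by
    have := hl a (by simp)
    match r with
    | [] => simp [Good]
    | c :: r => 
      have h2 := good_cons_max m (c :: r) hr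
      simp only [List.cons_append, List.nil_append, Good, h2]
      simp [not_lt.2 this.le]
  | true, [a, c], hl, h => by
    have := hl c (by simp)
    have h2 := good_even m r hr false [c] (by simpa using this) (by simp)
    simp only [List.cons_append, List.nil_append, Good] at h2 ⊢
    simp [not_lt.2 this.le, h2]
  | false, [a, c], hl, h => by simp at h
  | true, a :: c :: d :: l, hl, h => by
    have h2 := good_even m r hr false (c :: d :: l) (fun y hy => hl y (by simp at hy ⊢; tauto))
      (by simp at h ⊢; omega)
    simp only [List.cons_append, Good] at h2 ⊢
    rw [h2]; tauto
  | false, a :: c :: d :: l, hl, h => by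
    have h2 := good_even m r hr true (c :: d :: l) (fun y hy => hl y (by simp at hy ⊢; tauto))
      (by simp at h ⊢; omega)
    simp only [List.cons_append, Good] at h2 ⊢
    rw [h2]; tauto

lemma good_odd (m : α) (r : List α) (hr : ∀ y ∈ r, y < m) :
    ∀ (b : Bool) (l : List α), l ≠ [] → (∀ y ∈ l, y < m) →
    (l.length % 2 = if b then 1 else 0) →
    (Good b (l ++ m :: r) ↔ r = [] ∧ Good b l ∧ ¬ EndDesc l)
  | _, [], h, _, _ => by simp at h
  | false, [a], _, _, h => by simp at h
  | true, [a], _, hl, h => by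
    have := hl a (by simp)
    match r with
    | [] => simp [Good, EndDesc]
    | c :: r =>
      have := hr c (by simp)
      simp [Good, EndDesc, *]
  | false, [a, c], _, hl, h => by
    have := hl c (by simp)
    have h2 := good_odd m r hr true [c] (by simp) (by simpa using this) (by simp)
    simp only [List.cons_append, List.nil_append, Good, EndDesc] at h2 ⊢
    simp [this, h2]; tauto
  | true, [a, c], _, hl, h => by simp at h
  | true, a :: c :: d :: l, _, hl, h => by
    have h2 := good_odd m r hr false (c :: d :: l) (by simp) (fun y hy => hl y (by simp at hy ⊢; tauto))
      (by simp at h ⊢; omega)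
    simp only [List.cons_append, Good, EndDesc] at h2 ⊢
    rw [h2]; tauto
  | false, a :: c :: d :: l, _, hl, h => by
    have h2 := good_odd m r hr true (c :: d :: l) (by simp) (fun y hy => hl y (by simp at hy ⊢; tauto))
      (by simp at h ⊢; omega)
    simp only [List.cons_append, Good, EndDesc] at h2 ⊢
    rw [h2]; tauto

lemma endDesc_cons (a b c : α) (l : List α) : EndDesc (a :: b :: c :: l) ↔ EndDesc (b :: c :: l) := by
  simp [EndDesc]

lemma endDesc_append_max (m : α) (r : List α) (hr : ∀ y ∈ r, y < m) :
    ∀ (l : List α), (∀ y ∈ l, y < m) →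
    (EndDesc (l ++ m :: r) ↔ r.length = 1 ∨ EndDesc r)
  | [], _ => by
    match r with
    | [] => simp [EndDesc]
    | [a] => simpa [EndDesc] using hr a
    | a :: b :: t => simp [EndDesc]
  | [a], hl => by
    have := hl a (by simp)
    match r with
    | [] => simp [EndDesc, this.le]
    | [b] => simpa [EndDesc] using hr b
    | b :: c :: t => simp [EndDesc]
  | a :: c :: l, hl => by
    have h2 := endDesc_append_max m r hr (c :: l) (fun y hy => hl y (by simp at hy ⊢; tauto))
    rw [← h2]
    match l with
    | [] => simp [EndDesc]
    | d :: l => simp [EndDesc]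

lemma good_map_mono (e : α → β) (he : StrictMono e) : ∀ (b : Bool) (l : List α),
    Good b (l.map e) ↔ Good b l
  | _, [] => by simp [Good]
  | _, [_] => by simp [Good]
  | _, [_, _] => by simp [Good]
  | true, x :: y :: z :: t => by
    have := good_map_mono e he false (y :: z :: t)
    simp only [List.map_cons, Good, he.lt_iff_lt] at this ⊢
    rw [this]
  | false, x :: y :: z :: t => by
    have := good_map_mono e he true (y :: z :: t)
    simp only [List.map_cons, Good, he.lt_iff_lt] at this ⊢
    rw [this]

lemma good_map_anti (e : α → β) (he : StrictAnti e) : ∀ (b : Bool) (l : List α),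
    Good b (l.map e) ↔ Good (!b) l
  | _, [] => by simp [Good]
  | _, [_] => by simp [Good]
  | _, [_, _] => by simp [Good]
  | true, x :: y :: z :: t => by
    have := good_map_anti e he false (y :: z :: t)
    simp only [List.map_cons, Good, he.lt_iff_gt, Bool.not_true, Bool.not_false] at this ⊢
    rw [this]
  | false, x :: y :: z :: t => by
    have := good_map_anti e he true (y :: z :: t)
    simp only [List.map_cons, Good, he.lt_iff_gt, Bool.not_true, Bool.not_false] at this ⊢
    rw [this]

lemma endDesc_map_mono (e : α → β) (he : StrictMono e) : ∀ (l : List α),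
    EndDesc (l.map e) ↔ EndDesc l
  | [] => by simp [EndDesc]
  | [_] => by simp [EndDesc]
  | [_, _] => by simp [EndDesc, he.lt_iff_lt]
  | x :: y :: z :: t => by
    have := endDesc_map_mono e he (y :: z :: t)
    simpa [EndDesc] using this

lemma endDesc_map_anti (e : α → β) (he : StrictAnti e) : ∀ (l : List α), l.Nodup →
    (EndDesc (l.map e) ↔ 2 ≤ l.length ∧ ¬ EndDesc l)
  | [], _ => by simp [EndDesc]
  | [_], _ => by simp [EndDesc]
  | [a, b], h => by
    have : a ≠ b := by simpa using h
    simp [EndDesc, he.lt_iff_gt, this.le_iff_lt]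
  | x :: y :: z :: t, h => by
    have := endDesc_map_anti e he (y :: z :: t) h.of_cons
    simpa [EndDesc] using this

/-- index characterisation -/
lemma good_iff : ∀ (b : Bool) (l : List α), Good b l ↔ ∀ i (h : i + 2 < l.length),
    (((i + b.toNat) % 2 = 1 → ¬ (l[i] < l[i+1] ∧ l[i+2] < l[i+1])) ∧
     ((i + b.toNat) % 2 = 0 → ¬ (l[i+1] < l[i] ∧ l[i+1] < l[i+2])))
  | _, [] => by simp [Good]
  | _, [_] => by simp [Good]
  | _, [_, _] => by simp [Good]
  | true, x :: y :: z :: t => by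
    have := good_iff false (y :: z :: t)
    rw [Good, this]
    constructor
    · rintro ⟨h1, h2⟩ i hi
      cases i with
      | zero => simpa using h1
      | succ i =>
        have := h2 i (by simp at hi ⊢; omega)
        have e : (i + 1 + true.toNat) % 2 = (i + false.toNat) % 2 := by simp; omega
        rw [e]
        exact this
    · intro h
      refine ⟨by simpa using h 0 (by simp), fun i hi => ?_⟩
      have := h (i+1) (by simp at hi ⊢; omega)
      have e : (i + 1 + true.toNat) % 2 = (i + false.toNat) % 2 := by simp; omega
      rw [e] at this
      exact this
  | false, x :: y :: z :: t => by
    have := good_iff true (y :: z :: t)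
    rw [Good, this]
    constructor
    · rintro ⟨h1, h2⟩ i hi
      cases i with
      | zero => simpa using h1
      | succ i => exact h2 i (by simp at hi ⊢; omega)
    · intro h
      refine ⟨by simpa using h 0 (by simp), fun i hi => ?_⟩
      exact h (i+1) (by simp at hi ⊢; omega)

lemma endDesc_iff : ∀ (l : List α), EndDesc l ↔ ∃ h : 2 ≤ l.length,
    l[l.length - 1] < l[l.length - 2]
  | [] => by simp [EndDesc]
  | [_] => by simp [EndDesc]
  | [_, _] => by simp [EndDesc]
  | x :: y :: z :: t => by
    have := endDesc_iff (y :: z :: t)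
    simpa [EndDesc] using this
end

open Classical in
noncomputable def cnt (S : Finset ℕ) (P : List ℕ → Prop) : ℕ :=
  (S.toList.permutations.toFinset.filter P).card

lemma mem_L (S : Finset ℕ) (l : List ℕ) :
    l ∈ S.toList.permutations.toFinset ↔ l.Nodup ∧ ∀ a, a ∈ l ↔ a ∈ S := by
  rw [List.mem_toFinset, List.mem_permutations]
  constructor
  · intro h
    exact ⟨h.nodup_iff.2 S.nodup_toList, fun a => by rw [h.mem_iff, Finset.mem_toList]⟩
  · rintro ⟨h1, h2⟩
    rw [List.perm_ext_iff_of_nodup h1 S.nodup_toList]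
    simpa using h2

lemma card_L (S : Finset ℕ) : S.toList.permutations.toFinset.card = S.card.factorial := by
  rw [List.toFinset_card_of_nodup (List.nodup_permutations _ S.nodup_toList),
    List.length_permutations, Finset.length_toList]

lemma length_of_mem_L {S : Finset ℕ} {l : List ℕ} (h : l ∈ S.toList.permutations.toFinset) :
    l.length = S.card := by
  rw [List.mem_toFinset, List.mem_permutations] at h
  rw [h.length_eq, Finset.length_toList]

open Classical in
lemma cnt_perm {n : ℕ} (S : Finset ℕ) (hS : S.card = n) (e : Fin n → ℕ)
    (he : Function.Injective e) (heS : ∀ i, e i ∈ S) (P : List ℕ → Prop) :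
    cnt S P = Nat.card {σ : Equiv.Perm (Fin n) // P ((List.ofFn σ).map e)} := by
  have hsurj : ∀ a ∈ S, ∃ i, e i = a := by
    have : Finset.univ.image e = S := by
      apply Finset.eq_of_subset_of_card_le
      · intro a; simp only [Finset.mem_image]; rintro ⟨i, -, rfl⟩; exact heS i
      · rw [Finset.card_image_of_injective _ he]; simp [hS]
    intro a ha
    rw [← this] at ha
    simpa using ha
  have hinj : Function.Injective (fun σ : Equiv.Perm (Fin n) => (List.ofFn σ).map e) := by
    intro σ τ h
    have := List.map_injective_iff.2 he h
    exact Equiv.coe_fn_injective (List.ofFn_injective this)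
  have key : S.toList.permutations.toFinset =
      Finset.univ.image (fun σ : Equiv.Perm (Fin n) => (List.ofFn σ).map e) := by
    symm
    apply Finset.eq_of_subset_of_card_le
    · intro l hl
      simp only [Finset.mem_image] at hl
      obtain ⟨σ, -, rfl⟩ := hl
      rw [mem_L]
      refine ⟨(List.nodup_ofFn.2 σ.injective).map he, fun a => ?_⟩
      simp only [List.mem_map, List.mem_ofFn]
      constructor
      · rintro ⟨i, -, rfl⟩; exact heS i
      · intro ha
        obtain ⟨i, rfl⟩ := hsurj a ha
        exact ⟨i, ⟨σ.symm i, by simp⟩, rfl⟩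
    · rw [card_L, Finset.card_image_of_injective _ hinj, hS]
      simp [Fintype.card_perm]
  rw [cnt, key, Finset.filter_image, Finset.card_image_of_injective _ hinj, Nat.card_eq_fintype_card,
    Fintype.card_subtype]

noncomputable def F (n : ℕ) : ℕ := Nat.card {σ : Equiv.Perm (Fin n) // Good true (List.ofFn σ)}
noncomputable def G (n : ℕ) : ℕ :=
  Nat.card {σ : Equiv.Perm (Fin n) // Good true (List.ofFn σ) ∧ ¬ EndDesc (List.ofFn σ)}
noncomputable def H (n : ℕ) : ℕ :=
  Nat.card {σ : Equiv.Perm (Fin n) // Good true (List.ofFn σ) ∧ EndDesc (List.ofFn σ)}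

lemma F_eq (n : ℕ) : F n = G n + H n := by
  classical
  simp only [F, G, H, Nat.card_eq_fintype_card, Fintype.card_subtype]
  rw [← Finset.card_filter_add_card_filter_not (s := Finset.univ.filter _)
    (fun σ : Equiv.Perm (Fin n) => EndDesc (List.ofFn σ)), Finset.filter_filter,
    Finset.filter_filter, add_comm]

lemma emb_mono (S : Finset ℕ) : StrictMono (S.orderEmbOfFin rfl) := (S.orderEmbOfFin rfl).strictMono
lemma emb_anti (S : Finset ℕ) : StrictAnti (S.orderEmbOfFin rfl ∘ Fin.rev) :=
  (S.orderEmbOfFin rfl).strictMono.comp_strictAnti Fin.rev_strictAnti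

lemma cnt_F (S : Finset ℕ) : cnt S (Good true) = F S.card := by
  rw [cnt_perm S rfl _ (emb_mono S).injective (fun i => Finset.orderEmbOfFin_mem _ _ _)]
  simp only [good_map_mono _ (emb_mono S)]
  rfl

lemma cnt_F' (S : Finset ℕ) : cnt S (Good false) = F S.card := by
  rw [cnt_perm S rfl _ (emb_anti S).injective (fun i => Finset.orderEmbOfFin_mem _ _ _)]
  simp only [good_map_anti _ (emb_anti S)]
  rfl

lemma cnt_G (S : Finset ℕ) : cnt S (fun l => Good true l ∧ ¬ EndDesc l) = G S.card := by
  rw [cnt_perm S rfl _ (emb_mono S).injective (fun i => Finset.orderEmbOfFin_mem _ _ _)]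
  simp only [good_map_mono _ (emb_mono S), endDesc_map_mono _ (emb_mono S)]
  rfl

lemma endDesc_len {l : List ℕ} (h : EndDesc l) : 2 ≤ l.length := ((endDesc_iff l).1 h).1

lemma cnt_H (S : Finset ℕ) :
    cnt S (fun l => Good false l ∧ 2 ≤ l.length ∧ ¬ EndDesc l) = H S.card := by
  rw [cnt_perm S rfl _ (emb_anti S).injective (fun i => Finset.orderEmbOfFin_mem _ _ _)]
  simp only [good_map_anti _ (emb_anti S)]
  unfold H
  congr! 3
  rename_i σ
  rw [endDesc_map_anti _ (emb_anti S) _ (List.nodup_ofFn.2 σ.injective), List.length_map]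
  have := ((endDesc_iff (List.ofFn σ)).1 · |>.1)
  simp only [Bool.not_false]
  tauto

open Classical in
lemma cnt_insert (T : Finset ℕ) (m : ℕ) (hm : m ∉ T) (P : List ℕ → Prop) :
    cnt (insert m T) P = ∑ A ∈ T.powerset,
      ((A.toList.permutations.toFinset ×ˢ (T \ A).toList.permutations.toFinset).filter
        (fun p => P (p.1 ++ m :: p.2))).card := by
  rw [← Finset.card_sigma]
  symm
  refine Finset.card_bij (fun x _ => x.2.1 ++ m :: x.2.2) ?_ ?_ ?_
  · rintro ⟨A, l, r⟩ h
    simp only [Finset.mem_sigma, Finset.mem_powerset, Finset.mem_filter, Finset.mem_product,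
      mem_L, Finset.mem_sdiff, Finset.mem_insert] at h ⊢
    obtain ⟨hA, ⟨⟨hl, hl'⟩, hr, hr'⟩, hP⟩ := h
    refine ⟨⟨?_, ?_⟩, hP⟩
    · rw [List.nodup_append', List.nodup_cons]
      refine ⟨hl, ⟨?_, hr⟩, ?_⟩
      · rw [hr']; tauto
      · intro a ha hb
        rw [hl'] at ha
        rw [List.mem_cons, hr'] at hb
        rcases hb with rfl | hb
        · exact hm (hA ha)
        · exact hb.2 ha
    · intro a
      rw [List.mem_append, List.mem_cons, hl', hr']
      have := @hA a
      tauto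
  · rintro ⟨A, l, r⟩ h ⟨A', l', r'⟩ h' heq
    simp only [Finset.mem_sigma, Finset.mem_powerset, Finset.mem_filter, Finset.mem_product,
      mem_L, Finset.mem_sdiff] at h h'
    dsimp only at heq
    have hl : m ∉ l := fun hh => hm (h.1 ((h.2.1.1.2 m).1 hh))
    have hr : m ∉ r := fun hh => hm ((h.2.1.2.2 m).1 hh).1
    have hl' : m ∉ l' := fun hh => hm (h'.1 ((h'.2.1.1.2 m).1 hh))
    have hr' : m ∉ r' := fun hh => hm ((h'.2.1.2.2 m).1 hh).1
    obtain ⟨e1, e2, e3⟩ : l = l' ∧ m = m ∧ r = r' := by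
      rw [List.append_cons_inj_of_notMem hl hr] at heq
      tauto
    have : A = A' := by
      ext a; rw [← h.2.1.1.2, ← h'.2.1.1.2, e1]
    subst this e1 e3
    rfl
  · intro l h
    simp only [Finset.mem_filter, mem_L, Finset.mem_insert] at h
    obtain ⟨⟨hn, hl⟩, hP⟩ := h
    obtain ⟨s, t, rfl⟩ := List.append_of_mem ((hl m).2 (Or.inl rfl))
    refine ⟨⟨s.toFinset, s, t⟩, ?_, rfl⟩
    rw [List.nodup_append', List.nodup_cons] at hn
    obtain ⟨h1, ⟨h2, h3⟩, h4⟩ := hn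
    have key : ∀ a, a ∈ s → a ∈ T := by
      intro a ha
      rcases (hl a).1 (by simp [ha]) with rfl | h
      · exact absurd (h4 ha (by simp)) (by simp)
      · exact h
    simp only [Finset.mem_sigma, Finset.mem_powerset, Finset.mem_filter, Finset.mem_product,
      mem_L, Finset.mem_sdiff]
    refine ⟨fun a ha => key a (by simpa using ha), ⟨⟨h1, fun a => by simp⟩, h3, ?_⟩, hP⟩
    intro a
    rw [List.mem_toFinset]
    have := hl a
    rw [List.mem_append, List.mem_cons] at this
    have h5 : a ∈ s → a ∈ t → False := fun ha hb => h4 ha (by simp [hb])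
    have h6 : a = m → a ∉ t := by rintro rfl; exact h2
    have h7 : a = m → a ∉ T := by rintro rfl; exact hm
    tauto

open Classical in
lemma card_prod_filter (A B : Finset ℕ) (P : List ℕ × List ℕ → Prop) (Q R : List ℕ → Prop)
    (h : ∀ l ∈ A.toList.permutations.toFinset, ∀ r ∈ B.toList.permutations.toFinset,
      (P (l, r) ↔ Q l ∧ R r)) :
    ((A.toList.permutations.toFinset ×ˢ B.toList.permutations.toFinset).filter P).card
      = cnt A Q * cnt B R := by
  rw [cnt, cnt, ← Finset.card_product, ← Finset.filter_product]
  congr 1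
  apply Finset.filter_congr
  rintro ⟨l, r⟩ hlr
  rw [Finset.mem_product] at hlr
  exact h l hlr.1 r hlr.2

open Classical in
lemma cnt_nil' (S : Finset ℕ) (P : List ℕ → Prop) (hP : ∀ l, P l ↔ l = []) :
    cnt S P = if S.card = 0 then 1 else 0 := by
  split_ifs with h
  · rw [Finset.card_eq_zero] at h
    subst h
    rw [cnt, Finset.card_eq_one]
    refine ⟨[], ?_⟩
    ext l
    rw [Finset.mem_filter, hP, Finset.mem_singleton, mem_L]
    constructor
    · exact fun h => h.2
    · rintro rfl; simp
  · rw [cnt, Finset.card_eq_zero, Finset.filter_eq_empty_iff]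
    intro l hl hh
    rw [hP] at hh
    subst hh
    exact h (length_of_mem_L hl).symm

lemma cnt_nil (S : Finset ℕ) : cnt S (fun l => l = []) = if S.card = 0 then 1 else 0 :=
  cnt_nil' S _ (fun _ => Iff.rfl)

open Classical in
lemma cnt_or (S : Finset ℕ) (P Q : List ℕ → Prop) (h : ∀ l, P l → ¬ Q l) :
    cnt S (fun l => P l ∨ Q l) = cnt S P + cnt S Q := by
  rw [cnt, cnt, cnt, ← Finset.card_union_of_disjoint]
  · congr 1
    ext l
    simp only [Finset.mem_filter, Finset.mem_union]
    tauto
  · rw [Finset.disjoint_filter]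
    exact fun l _ => h l

lemma F_succ (n : ℕ) : F (n + 1) = ∑ k ∈ Finset.range (n + 1), n.choose k *
    (if k % 2 = 0 then F k * F (n - k) else G k * if n - k = 0 then 1 else 0) := by
  have h0 : F (n + 1) = cnt (insert n (Finset.range n)) (Good true) := by
    rw [cnt_F, Finset.card_insert_of_notMem (by simp), Finset.card_range]
  rw [h0, cnt_insert _ _ (by simp)]
  have := Finset.sum_powerset_apply_card (fun k =>
    (if k % 2 = 0 then F k * F (n - k) else G k * if n - k = 0 then 1 else 0))
    (x := Finset.range n)
  simp only [Finset.card_range, smul_eq_mul] at this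
  rw [← this]
  apply Finset.sum_congr rfl
  intro A hA
  rw [Finset.mem_powerset] at hA
  have hc : (Finset.range n \ A).card = n - A.card := by
    rw [Finset.card_sdiff_of_subset hA, Finset.card_range]
  have hlA : ∀ l ∈ A.toList.permutations.toFinset, ∀ y ∈ l, y < n := by
    intro l hl y hy
    rw [mem_L] at hl
    simpa using hA ((hl.2 y).1 hy)
  have hrA : ∀ l ∈ (Finset.range n \ A).toList.permutations.toFinset, ∀ y ∈ l, y < n := by
    intro l hl y hy
    rw [mem_L] at hl
    have := ((hl.2 y).1 hy)
    simp at this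
    exact this.1
  split_ifs with h1 h2
  · rw [card_prod_filter A _ _ (Good true) (Good false), cnt_F, cnt_F', hc]
    intro l hl r hr
    exact good_even n r (hrA r hr) true l (hlA l hl) (by simpa [length_of_mem_L hl] using h1)
  all_goals
    rw [card_prod_filter A _ _ (fun l => Good true l ∧ ¬ EndDesc l) (fun l => l = []), cnt_G, cnt_nil,
      hc]
    · simp [h2]
    intro l hl r hr
    have hlen := length_of_mem_L hl
    have := good_odd n r (hrA r hr) true l (by rintro rfl; simp at hlen; omega) (hlA l hl)
      (by simp [hlen]; omega)
    simp only [this]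
    tauto

lemma G_succ (n : ℕ) : G (n + 1) = ∑ k ∈ Finset.range (n + 1), n.choose k *
    (if k % 2 = 0 then F k * (H (n - k) + if n - k = 0 then 1 else 0)
      else G k * if n - k = 0 then 1 else 0) := by
  have h0 : G (n + 1) = cnt (insert n (Finset.range n)) (fun l => Good true l ∧ ¬ EndDesc l) := by
    rw [cnt_G, Finset.card_insert_of_notMem (by simp), Finset.card_range]
  rw [h0, cnt_insert _ _ (by simp)]
  have := Finset.sum_powerset_apply_card (fun k =>
    (if k % 2 = 0 then F k * (H (n - k) + if n - k = 0 then 1 else 0)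
      else G k * if n - k = 0 then 1 else 0))
    (x := Finset.range n)
  simp only [Finset.card_range, smul_eq_mul] at this
  rw [← this]
  apply Finset.sum_congr rfl
  intro A hA
  rw [Finset.mem_powerset] at hA
  have hc : (Finset.range n \ A).card = n - A.card := by
    rw [Finset.card_sdiff_of_subset hA, Finset.card_range]
  have hlA : ∀ l ∈ A.toList.permutations.toFinset, ∀ y ∈ l, y < n := by
    intro l hl y hy
    rw [mem_L] at hl
    simpa using hA ((hl.2 y).1 hy)
  have hrA : ∀ l ∈ (Finset.range n \ A).toList.permutations.toFinset, ∀ y ∈ l, y < n := by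
    intro l hl y hy
    rw [mem_L] at hl
    have := ((hl.2 y).1 hy)
    simp at this
    exact this.1
  by_cases h1 : A.card % 2 = 0
  · rw [if_pos h1, card_prod_filter A _ _ (Good true)
      (fun r => (Good false r ∧ 2 ≤ r.length ∧ ¬ EndDesc r) ∨ r = []), cnt_F, ← hc, ← cnt_H, ← cnt_nil]
    · congr 1
      rw [cnt_or]
      rintro l h rfl
      simp at h
    intro l hl r hr
    have e1 := good_even n r (hrA r hr) true l (hlA l hl) (by simpa [length_of_mem_L hl] using h1)
    have e2 := endDesc_append_max n r (hrA r hr) l (hlA l hl)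
    simp only [e1, e2]
    match r with
    | [] => simp [Good, EndDesc]
    | [a] => simp [EndDesc]
    | a :: b :: t => simp [and_assoc]
  · rw [if_neg h1, card_prod_filter A _ _ (fun l => Good true l ∧ ¬ EndDesc l) (fun l => l = []),
      cnt_G, cnt_nil, hc]
    intro l hl r hr
    have hlen := length_of_mem_L hl
    have e1 := good_odd n r (hrA r hr) true l (by rintro rfl; simp at hlen; omega) (hlA l hl)
      (by simp [hlen]; omega)
    have e2 := endDesc_append_max n r (hrA r hr) l (hlA l hl)
    simp only [e1, e2]
    match r with
    | [] => simp [EndDesc]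
    | a :: t => simp


lemma permEnt_succ {n : ℕ} (σ : Equiv.Perm (Fin n)) (i : ℕ) (h : i < n) :
    permEnt σ (i + 1) = (σ ⟨i, h⟩ : ℕ) + 1 := by
  rw [permEnt, dif_pos ⟨by omega, by omega⟩]
  simp

lemma goodPerm_iff {n : ℕ} (σ : Equiv.Perm (Fin n)) :
    GoodPerm σ ↔ Good true (List.ofFn σ) := by
  rw [good_iff]
  simp only [List.length_ofFn, List.getElem_ofFn, Bool.toNat_true]
  constructor
  · rintro ⟨hv, hp⟩ i hi
    constructor
    · intro h1 h2
      have := hp (i + 2) ⟨by omega, hi, by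
        rw [show i + 2 - 1 = i + 1 by omega, permEnt_succ σ i (by omega),
          permEnt_succ σ (i + 1) (by omega), permEnt_succ σ (i + 2) (by omega)]
        simp only [Fin.lt_def] at h2
        omega⟩
      omega
    · intro h1 h2
      have := hv (i + 2) ⟨by omega, hi, by
        rw [show i + 2 - 1 = i + 1 by omega, permEnt_succ σ i (by omega),
          permEnt_succ σ (i + 1) (by omega), permEnt_succ σ (i + 2) (by omega)]
        simp only [Fin.lt_def] at h2
        omega⟩
      omega
  · intro h
    constructor
    · rintro j ⟨h1, h2, h3⟩
      obtain ⟨i, rfl⟩ := Nat.exists_eq_add_of_le' h1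
      rw [show i + 2 - 1 = i + 1 by omega, permEnt_succ σ i (by omega),
          permEnt_succ σ (i + 1) (by omega), permEnt_succ σ (i + 2) (by omega)] at h3
      by_contra hc
      apply (h i h2).2 (by omega)
      simp only [Fin.lt_def]
      omega
    · rintro j ⟨h1, h2, h3⟩
      obtain ⟨i, rfl⟩ := Nat.exists_eq_add_of_le' h1
      rw [show i + 2 - 1 = i + 1 by omega, permEnt_succ σ i (by omega),
          permEnt_succ σ (i + 1) (by omega), permEnt_succ σ (i + 2) (by omega)] at h3
      by_contra hc
      apply (h i h2).1 (by omega)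
      simp only [Fin.lt_def]
      omega

lemma isDescent_iff {n : ℕ} (σ : Equiv.Perm (Fin n)) :
    IsDescent σ (n - 1) ↔ EndDesc (List.ofFn σ) := by
  rw [endDesc_iff]
  simp only [List.length_ofFn, List.getElem_ofFn]
  constructor
  · rintro ⟨h1, h2, h3⟩
    obtain ⟨i, rfl⟩ : ∃ i, n = i + 2 := ⟨n - 2, by omega⟩
    refine ⟨by omega, ?_⟩
    rw [show i + 2 - 1 = i + 1 by omega, permEnt_succ σ i (by omega),
          permEnt_succ σ (i + 1) (by omega)] at h3
    simp only [Fin.lt_def, show i + 2 - 1 = i + 1 by omega, show i + 2 - 2 = i by omega]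
    omega
  · rintro ⟨h1, h2⟩
    obtain ⟨i, rfl⟩ : ∃ i, n = i + 2 := ⟨n - 2, by omega⟩
    refine ⟨by omega, by omega, ?_⟩
    rw [show i + 2 - 1 = i + 1 by omega, permEnt_succ σ i (by omega),
          permEnt_succ σ (i + 1) (by omega)]
    simp only [Fin.lt_def, show i + 2 - 1 = i + 1 by omega, show i + 2 - 2 = i by omega] at h2
    omega

lemma fCount_eq (n : ℕ) : fCount n = F n := by
  simp only [fCount, F, goodPerm_iff]

lemma gCount_eq (n : ℕ) : gCount n = G n := by
  simp only [gCount, G, goodPerm_iff, isDescent_iff]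

lemma F_zero : F 0 = 1 := by
  simp [F, Good]
lemma G_zero : G 0 = 1 := by
  simp [G, Good, EndDesc]

lemma F_le (n : ℕ) : F n ≤ n.factorial := by
  have := Nat.card_le_card_of_injective (fun σ : {σ : Equiv.Perm (Fin n) // Good true (List.ofFn σ)} => σ.1) Subtype.val_injective
  simpa [F, Nat.card_eq_fintype_card, Fintype.card_perm] using this

lemma G_le (n : ℕ) : G n ≤ n.factorial := (F_eq n ▸ Nat.le_add_right _ _ : G n ≤ F n).trans (F_le n)

noncomputable def fo (n : ℕ) : ℝ := (if n % 2 = 1 then (F n : ℝ) else 0) / n.factorial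
noncomputable def fe (n : ℕ) : ℝ := (if n % 2 = 0 then (F n : ℝ) else 0) / n.factorial
noncomputable def go (n : ℕ) : ℝ := (if n % 2 = 1 then (G n : ℝ) else 0) / n.factorial
noncomputable def ge (n : ℕ) : ℝ := (if n % 2 = 0 then (G n : ℝ) else 0) / n.factorial

lemma abs_div_fact_le (p : Prop) [Decidable p] (n m : ℕ) (h : m ≤ n.factorial) :
    |(if p then (m : ℝ) else 0) / n.factorial| ≤ 1 := by
  have h0 : (0 : ℝ) < n.factorial := by exact_mod_cast n.factorial_pos
  have h1 : (m : ℝ) ≤ n.factorial := by exact_mod_cast h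
  rw [abs_div, abs_of_pos h0, div_le_one h0]
  split_ifs
  · rwa [abs_of_nonneg (by positivity)]
  · simpa using h0.le

lemma fo_le (n : ℕ) : |fo n| ≤ 1 := abs_div_fact_le _ n _ (F_le n)
lemma fe_le (n : ℕ) : |fe n| ≤ 1 := abs_div_fact_le _ n _ (F_le n)
lemma go_le (n : ℕ) : |go n| ≤ 1 := abs_div_fact_le _ n _ (G_le n)
lemma ge_le (n : ℕ) : |ge n| ≤ 1 := abs_div_fact_le _ n _ (G_le n)

/-- general normalisation of a binomial recurrence -/
lemma norm_rec (n : ℕ) (c : ℕ → ℕ → ℝ) :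
    ((n + 1 : ℕ) : ℝ) * ((∑ k ∈ Finset.range (n + 1), (n.choose k : ℝ) * c k (n - k)) / (n + 1).factorial)
    = ∑ p ∈ Finset.HasAntidiagonal.antidiagonal n, c p.1 p.2 / (p.1.factorial * p.2.factorial) := by
  rw [Finset.Nat.sum_antidiagonal_eq_sum_range_succ
    (f := fun i j => c i j / ((i.factorial : ℝ) * j.factorial)), Finset.sum_div, Finset.mul_sum]
  apply Finset.sum_congr rfl
  intro k hk
  have hk' : k ≤ n := by simpa [Nat.lt_succ_iff] using hk
  rw [Nat.cast_choose ℝ hk', Nat.factorial_succ]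
  have : (n.factorial : ℝ) ≠ 0 := by exact_mod_cast n.factorial_ne_zero
  have : (k.factorial : ℝ) ≠ 0 := by exact_mod_cast k.factorial_ne_zero
  have : ((n - k).factorial : ℝ) ≠ 0 := by exact_mod_cast (n - k).factorial_ne_zero
  have : ((n + 1 : ℕ) : ℝ) ≠ 0 := by exact_mod_cast n.succ_ne_zero
  push_cast at *
  field_simp

lemma sum_delta (n : ℕ) (a : ℕ → ℝ) :
    ∑ p ∈ Finset.HasAntidiagonal.antidiagonal n, a p.1 * (if p.2 = 0 then 1 else 0) = a n := by
  rw [Finset.Nat.sum_antidiagonal_eq_sum_range_succ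
    (f := fun i j => a i * (if j = 0 then 1 else 0)), Finset.sum_eq_single n]
  · simp
  · intro b hb hb'
    have : n - b ≠ 0 := by simp at hb; omega
    simp [this]
  · simp

lemma H_eq (n : ℕ) : (H n : ℝ) = F n - G n := by
  rw [F_eq]; push_cast; ring

lemma rec_fo (n : ℕ) : ((n + 1 : ℕ) : ℝ) * fo (n + 1) =
    ∑ p ∈ Finset.HasAntidiagonal.antidiagonal n, fe p.1 * fe p.2 := by
  by_cases hn : n % 2 = 0
  · rw [fo, if_pos (by omega), F_succ]
    push_cast
    have := norm_rec n (fun k j => if k % 2 = 0 then (F k : ℝ) * F j else G k * if j = 0 then 1 else 0)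
    push_cast at this
    rw [this]
    apply Finset.sum_congr rfl
    rintro ⟨i, j⟩ h
    rw [Finset.HasAntidiagonal.mem_antidiagonal] at h
    dsimp only at h ⊢
    by_cases hi : i % 2 = 0
    · simp only [fe, hi, show j % 2 = 0 by omega, if_true]
      field_simp
    · simp only [fe, hi, show ¬ j = 0 by omega, if_false]
      simp
  · rw [fo, if_neg (by omega)]
    simp only [zero_div, mul_zero]
    symm
    apply Finset.sum_eq_zero
    rintro ⟨i, j⟩ h
    rw [Finset.HasAntidiagonal.mem_antidiagonal] at h
    dsimp only at h ⊢
    by_cases hi : i % 2 = 0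
    · simp [fe, show ¬ j % 2 = 0 by omega]
    · simp [fe, hi]

lemma rec_fe (n : ℕ) : ((n + 1 : ℕ) : ℝ) * fe (n + 1) =
    (∑ p ∈ Finset.HasAntidiagonal.antidiagonal n, fe p.1 * fo p.2) + go n := by
  rw [← sum_delta n go, ← Finset.sum_add_distrib]
  by_cases hn : n % 2 = 1
  · rw [fe, if_pos (by omega), F_succ]
    push_cast
    have := norm_rec n (fun k j => if k % 2 = 0 then (F k : ℝ) * F j else G k * if j = 0 then 1 else 0)
    push_cast at this
    rw [this]
    apply Finset.sum_congr rfl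
    rintro ⟨i, j⟩ h
    rw [Finset.HasAntidiagonal.mem_antidiagonal] at h
    dsimp only at h ⊢
    by_cases hi : i % 2 = 0
    · simp only [fe, fo, go, hi, show j % 2 = 1 by omega, if_true]
      simp
      field_simp
    · simp only [fe, fo, go, hi, show i % 2 = 1 by omega, if_false, if_true]
      by_cases hj : j = 0 <;> simp [hj]
  · rw [fe, if_neg (by omega)]
    simp only [zero_div, mul_zero]
    symm
    apply Finset.sum_eq_zero
    rintro ⟨i, j⟩ h
    rw [Finset.HasAntidiagonal.mem_antidiagonal] at h
    dsimp only at h ⊢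
    by_cases hi : i % 2 = 0
    · simp [fe, fo, go, hi, show ¬ j % 2 = 1 by omega]
    · simp [fe, go, hi, show ¬ j = 0 by omega]

lemma rec_go (n : ℕ) : ((n + 1 : ℕ) : ℝ) * go (n + 1) =
    (∑ p ∈ Finset.HasAntidiagonal.antidiagonal n, fe p.1 * (fe p.2 - ge p.2)) + fe n := by
  rw [← sum_delta n fe, ← Finset.sum_add_distrib]
  by_cases hn : n % 2 = 0
  · rw [go, if_pos (by omega), G_succ]
    push_cast
    have := norm_rec n (fun k j => if k % 2 = 0 then (F k : ℝ) * (H j + if j = 0 then 1 else 0)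
      else G k * if j = 0 then 1 else 0)
    push_cast at this
    rw [this]
    apply Finset.sum_congr rfl
    rintro ⟨i, j⟩ h
    rw [Finset.HasAntidiagonal.mem_antidiagonal] at h
    dsimp only at h ⊢
    by_cases hi : i % 2 = 0
    · simp only [fe, ge, hi, show j % 2 = 0 by omega, if_true, H_eq]
      by_cases hj : j = 0
      · subst hj; simp; field_simp
      · simp only [hj, if_false]; field_simp; ring
    · simp only [fe, hi, show ¬ j = 0 by omega, if_false]
      simp
  · rw [go, if_neg (by omega)]
    simp only [zero_div, mul_zero]
    symm
    apply Finset.sum_eq_zero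
    rintro ⟨i, j⟩ h
    rw [Finset.HasAntidiagonal.mem_antidiagonal] at h
    dsimp only at h ⊢
    by_cases hi : i % 2 = 0
    · simp [fe, ge, show ¬ j % 2 = 0 by omega, show ¬ j = 0 by omega]
    · simp [fe, hi]

lemma rec_ge (n : ℕ) : ((n + 1 : ℕ) : ℝ) * ge (n + 1) =
    (∑ p ∈ Finset.HasAntidiagonal.antidiagonal n, fe p.1 * (fo p.2 - go p.2)) + go n := by
  rw [← sum_delta n go, ← Finset.sum_add_distrib]
  by_cases hn : n % 2 = 1
  · rw [ge, if_pos (by omega), G_succ]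
    push_cast
    have := norm_rec n (fun k j => if k % 2 = 0 then (F k : ℝ) * (H j + if j = 0 then 1 else 0)
      else G k * if j = 0 then 1 else 0)
    push_cast at this
    rw [this]
    apply Finset.sum_congr rfl
    rintro ⟨i, j⟩ h
    rw [Finset.HasAntidiagonal.mem_antidiagonal] at h
    dsimp only at h ⊢
    by_cases hi : i % 2 = 0
    · simp only [fe, fo, go, hi, show j % 2 = 1 by omega, show ¬ j = 0 by omega, if_true, if_false, H_eq]
      simp
      field_simp
    · simp only [fe, fo, go, hi, show i % 2 = 1 by omega, if_false, if_true]
      by_cases hj : j = 0 <;> simp [hj]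
  · rw [ge, if_neg (by omega)]
    simp only [zero_div, mul_zero]
    symm
    apply Finset.sum_eq_zero
    rintro ⟨i, j⟩ h
    rw [Finset.HasAntidiagonal.mem_antidiagonal] at h
    dsimp only at h ⊢
    by_cases hi : i % 2 = 0
    · simp [fe, fo, go, hi, show ¬ j % 2 = 1 by omega]
    · simp [fe, go, hi, show ¬ j = 0 by omega]


section analysis
open Real

lemma summ (a : ℕ → ℝ) (ha : ∀ n, |a n| ≤ 1) (x : ℝ) (hx : |x| < 1) :
    Summable (fun n => ‖a n * x ^ n‖) := by
  refine Summable.of_nonneg_of_le (fun _ => norm_nonneg _) (fun n => ?_)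
    (summable_geometric_of_lt_one (abs_nonneg x) hx)
  rw [norm_mul, norm_pow, Real.norm_eq_abs, Real.norm_eq_abs]
  exact mul_le_of_le_one_left (by positivity) (ha n)

noncomputable def ps (a : ℕ → ℝ) (x : ℝ) : ℝ := ∑' n, a n * x ^ n

lemma ps_zero (a : ℕ → ℝ) : ps a 0 = a 0 := by
  rw [ps, tsum_eq_single 0]
  · simp
  · intro n hn; simp [hn]

lemma ps_deriv (a : ℕ → ℝ) (ha : ∀ n, |a n| ≤ 1) (x : ℝ) (hx : |x| < 1) :
    HasDerivAt (ps a) (∑' n : ℕ, ((n + 1 : ℕ) * a (n + 1)) * x ^ n) x := by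
  obtain ⟨r, hr1, hr2⟩ := exists_between hx
  have hr0 : 0 ≤ r := (abs_nonneg x).trans hr1.le
  have hs : Summable (fun n : ℕ => (n : ℝ) * r ^ (n - 1)) := by
    rw [← summable_nat_add_iff 1]
    have h1 := summable_pow_mul_geometric_of_norm_lt_one 1 (r := r) (by rwa [norm_eq_abs, abs_of_nonneg hr0])
    have h2 := summable_geometric_of_lt_one hr0 hr2
    refine (h1.add h2).congr (fun n => ?_)
    simp; ring_nf
  have key : ∀ n : ℕ, ∀ y ∈ Set.Ioo (-r) r, ‖a n * (n * y ^ (n - 1))‖ ≤ n * r ^ (n - 1) := by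
    intro n y hy
    have hy' : |y| ≤ r := (abs_lt.2 hy).le
    rw [norm_mul, norm_mul, norm_pow, norm_eq_abs, norm_eq_abs, norm_eq_abs, Nat.abs_cast]
    calc |a n| * (n * |y| ^ (n - 1)) ≤ 1 * (n * r ^ (n - 1)) := by
          gcongr
          exact ha n
      _ = _ := one_mul _
  have hx' : x ∈ Set.Ioo (-r) r := abs_lt.1 hr1
  have h := hasDerivAt_tsum_of_isPreconnected (g := fun n y => a n * y ^ n)
    (g' := fun n y => a n * (n * y ^ (n - 1))) hs isOpen_Ioo isPreconnected_Ioo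
    (fun n y _ => (hasDerivAt_pow n y).const_mul (a n)) key hx' (summ a ha x hx).of_norm hx'
  refine HasDerivAt.congr_deriv h ?_
  have hsum : Summable (fun n => a n * (n * x ^ (n - 1))) :=
    Summable.of_norm_bounded hs (fun n => key n x hx')
  rw [hsum.tsum_eq_zero_add]
  simp only [Nat.cast_zero, zero_mul, mul_zero, zero_add, Nat.add_sub_cancel]
  congr 1; ext n; ring

lemma ps_mul (a b : ℕ → ℝ) (x : ℝ)
    (ha : Summable (fun n => ‖a n * x ^ n‖)) (hb : Summable (fun n => ‖b n * x ^ n‖)) :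
    ps a x * ps b x = ∑' n, (∑ p ∈ Finset.HasAntidiagonal.antidiagonal n, a p.1 * b p.2) * x ^ n := by
  rw [ps, ps, tsum_mul_tsum_eq_tsum_sum_antidiagonal_of_summable_norm ha hb]
  congr 1; ext n
  rw [Finset.sum_mul]
  apply Finset.sum_congr rfl
  rintro ⟨i, j⟩ h
  rw [Finset.HasAntidiagonal.mem_antidiagonal] at h
  subst h
  dsimp only
  rw [pow_add]; ring

lemma ps_mul_summ (a b : ℕ → ℝ) (x : ℝ)
    (ha : Summable (fun n => ‖a n * x ^ n‖)) (hb : Summable (fun n => ‖b n * x ^ n‖)) :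
    Summable (fun n => (∑ p ∈ Finset.HasAntidiagonal.antidiagonal n, a p.1 * b p.2) * x ^ n) := by
  have := (summable_norm_sum_mul_antidiagonal_of_summable_norm ha hb).of_norm
  refine this.congr (fun n => ?_)
  rw [Finset.sum_mul]
  apply Finset.sum_congr rfl
  rintro ⟨i, j⟩ h
  rw [Finset.HasAntidiagonal.mem_antidiagonal] at h
  subst h
  dsimp only
  rw [pow_add]; ring

/-- If `(n+1) a_{n+1} = ∑ b_i (c_j - d_j) + e_n` then `deriv A = B (C - D) + E`. -/
lemma ps_ode (a b c d e : ℕ → ℝ) (ha : ∀ n, |a n| ≤ 1) (hb : ∀ n, |b n| ≤ 1) (hc : ∀ n, |c n| ≤ 1)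
    (hd : ∀ n, |d n| ≤ 1) (he : ∀ n, |e n| ≤ 1)
    (h : ∀ n : ℕ, ((n + 1 : ℕ) : ℝ) * a (n + 1) =
      (∑ p ∈ Finset.HasAntidiagonal.antidiagonal n, b p.1 * (c p.2 - d p.2)) + e n) (x : ℝ) (hx : |x| < 1) :
    HasDerivAt (ps a) (ps b x * (ps c x - ps d x) + ps e x) x := by
  refine HasDerivAt.congr_deriv (ps_deriv a ha x hx) ?_
  symm
  have e1 : ps c x - ps d x = ps (fun n => c n - d n) x := by
    rw [ps, ps, ps, ← Summable.tsum_sub (summ c hc x hx).of_norm (summ d hd x hx).of_norm]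
    congr 1; ext n; ring
  have e2 : Summable (fun n => ‖(c n - d n) * x ^ n‖) := by
    refine Summable.of_nonneg_of_le (fun _ => norm_nonneg _) (fun n => ?_)
      ((summ c hc x hx).add (summ d hd x hx))
    rw [sub_mul]; exact norm_sub_le _ _
  have hb' := summ b hb x hx
  rw [e1, ps_mul _ _ _ hb' e2, ps, ← Summable.tsum_add (ps_mul_summ _ _ _ hb' e2)
    (summ e he x hx).of_norm]
  congr 1; ext n
  rw [h]; ring

/-- vector field -/
def vf (y : ℝ × ℝ × ℝ × ℝ) : ℝ × ℝ × ℝ × ℝ :=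
  (y.2.1 * y.2.1, y.2.1 * y.1 + y.2.2.1, y.2.1 * (y.2.1 - y.2.2.2) + y.2.1,
    y.2.1 * (y.1 - y.2.2.1) + y.2.2.1)

lemma vf_contDiff : ContDiff ℝ 1 vf := by unfold vf; fun_prop

lemma ode_unique (u w : ℝ → ℝ × ℝ × ℝ × ℝ)
    (hu : ∀ t, |t| < 1 → HasDerivAt u (vf (u t)) t)
    (hw : ∀ t, |t| < 1 → HasDerivAt w (vf (w t)) t) (h0 : u 0 = w 0) (x : ℝ) (hx : |x| < 1) :
    u x = w x := by
  obtain ⟨r, hr1, hr2⟩ := exists_between hx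
  have hin : ∀ t ∈ Set.Icc (-r) r, |t| < 1 := fun t ht => (abs_le.2 ht).trans_lt hr2
  have hcu : ContinuousOn u (Set.Icc (-r) r) :=
    fun t ht => (hu t (hin t ht)).continuousAt.continuousWithinAt
  have hcw : ContinuousOn w (Set.Icc (-r) r) :=
    fun t ht => (hw t (hin t ht)).continuousAt.continuousWithinAt
  obtain ⟨R1, hR1⟩ := isCompact_Icc.exists_bound_of_continuousOn hcu
  obtain ⟨R2, hR2⟩ := isCompact_Icc.exists_bound_of_continuousOn hcw
  obtain ⟨K, hK⟩ := (vf_contDiff.locallyLipschitz.locallyLipschitzOn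
    (s := Metric.closedBall 0 (max R1 R2))).exists_lipschitzOnWith_of_compact
    (isCompact_closedBall _ _)
  have := ODE_solution_unique_of_mem_Ioo (v := fun _ => vf) (f := u) (g := w) (a := -r) (b := r)
    (t₀ := 0) (K := K) (s := fun _ => Metric.closedBall 0 (max R1 R2))
    (fun _ _ => hK) (by have := abs_nonneg x; constructor <;> linarith)
    (fun t ht => ⟨hu t (hin t (Set.Ioo_subset_Icc_self ht)), by
      simpa using Or.inl (hR1 t (Set.Ioo_subset_Icc_self ht))⟩)
    (fun t ht => ⟨hw t (hin t (Set.Ioo_subset_Icc_self ht)), by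
      simpa using Or.inr (hR2 t (Set.Ioo_subset_Icc_self ht))⟩) h0
  exact this (abs_lt.1 hr1)

lemma D_pos (x : ℝ) (hx : |x| < 1) : 0 < 3 * cos x + 4 - cosh (√3 * x) := by
  have hx2 : x ^ 2 < 1 := by rw [← sq_abs]; have := abs_nonneg x; nlinarith
  have h1 := one_sub_sq_div_two_le_cos (x := x)
  have h2 := cosh_le_exp_half_sq (√3 * x)
  have h3 : exp ((√3 * x) ^ 2 / 2) ≤ exp (3 / 2) := by
    apply exp_le_exp.2
    rw [mul_pow, sq_sqrt (by norm_num)]; linarith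
  have h4 : exp (3 / 2) < 5 := by
    have : exp (3 / 2) * exp (3/2) = exp 1 ^ 3 := by
      rw [← exp_add, ← exp_nat_mul]; norm_num
    have h5 := exp_one_lt_d9
    have h6 : exp 1 ^ 3 < 2.72 ^ 3 := by gcongr; linarith
    have h7 := exp_pos (3 / 2)
    nlinarith
  linarith

noncomputable def cD (x : ℝ) : ℝ := 3 * cos x + 4 - cosh (√3 * x)
noncomputable def c1 (x : ℝ) : ℝ := √3 * sinh (√3 * x) + 3 * sin x
noncomputable def c2 (x : ℝ) : ℝ := 2 * √3 * sin (x / 2) * sinh (√3 * x / 2) +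
        6 * cos (x / 2) * cosh (√3 * x / 2)
noncomputable def c3 (x : ℝ) : ℝ := 4 * √3 * cos (x / 2) * sinh (√3 * x / 2)
noncomputable def c4 (x : ℝ) : ℝ := 6 * cos (x / 2) * cosh (√3 * x / 2) +
        2 * √3 * sin (x / 2) * sinh (√3 * x / 2) + 2 - 2 * cosh (√3 * x)

lemma hs (x : ℝ) : HasDerivAt (fun x => sin (x / 2)) (cos (x / 2) / 2) x := by
  simpa [div_eq_mul_inv] using ((hasDerivAt_id x).div_const 2).sin
lemma hc (x : ℝ) : HasDerivAt (fun x => cos (x / 2)) (- sin (x / 2) / 2) x := by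
  simpa [div_eq_mul_inv] using ((hasDerivAt_id x).div_const 2).cos
lemma hS (x : ℝ) : HasDerivAt (fun x => sinh (√3 * x / 2)) (√3 * cosh (√3 * x / 2) / 2) x := by
  refine HasDerivAt.congr_deriv ((((hasDerivAt_id x).const_mul √3).div_const 2).sinh) ?_
  simp; ring_nf
lemma hC (x : ℝ) : HasDerivAt (fun x => cosh (√3 * x / 2)) (√3 * sinh (√3 * x / 2) / 2) x := by
  refine HasDerivAt.congr_deriv ((((hasDerivAt_id x).const_mul √3).div_const 2).cosh) ?_
  simp; ring_nf

lemma eD (x : ℝ) : cD x = 6 * cos (x / 2) ^ 2 + 2 - 2 * cosh (√3 * x / 2) ^ 2 := by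
  have h1 : cos x = 2 * cos (x / 2) ^ 2 - 1 := by rw [← cos_two_mul]; congr 1; ring
  have h2 : cosh (√3 * x) = 2 * cosh (√3 * x / 2) ^ 2 - 1 := by
    have := cosh_two_mul (√3 * x / 2)
    rw [show 2 * (√3 * x / 2) = √3 * x by ring] at this
    rw [this, cosh_sq]; ring
  rw [cD, h1, h2]; ring
lemma e1 (x : ℝ) : c1 x = 2 * √3 * (sinh (√3 * x / 2) * cosh (√3 * x / 2))
    + 6 * (sin (x / 2) * cos (x / 2)) := by
  have h1 : sin x = 2 * sin (x / 2) * cos (x / 2) := by rw [← sin_two_mul]; congr 1; ring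
  have h2 : sinh (√3 * x) = 2 * sinh (√3 * x / 2) * cosh (√3 * x / 2) := by
    rw [← sinh_two_mul]; congr 1; ring
  rw [c1, h1, h2]; ring
lemma e4 (x : ℝ) : c4 x = 6 * (cos (x / 2) * cosh (√3 * x / 2)) +
        2 * √3 * (sin (x / 2) * sinh (√3 * x / 2)) + 4 - 4 * cosh (√3 * x / 2) ^ 2 := by
  have h2 : cosh (√3 * x) = 2 * cosh (√3 * x / 2) ^ 2 - 1 := by
    have := cosh_two_mul (√3 * x / 2)
    rw [show 2 * (√3 * x / 2) = √3 * x by ring] at this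
    rw [this, cosh_sq]; ring
  rw [c4, h2]; ring

lemma dD (x : ℝ) : HasDerivAt cD (-6 * (cos (x/2) * sin (x/2))
    - 2 * √3 * (cosh (√3 * x / 2) * sinh (√3 * x / 2))) x := by
  rw [funext eD]
  refine HasDerivAt.congr_deriv (((((hc x).pow 2).const_mul 6).add_const 2).sub (((hC x).pow 2).const_mul 2)) ?_
  simp; ring_nf
lemma d1 (x : ℝ) : HasDerivAt c1 (3 * (cosh (√3 * x / 2) ^ 2 + sinh (√3 * x / 2) ^ 2)
    + 3 * (cos (x/2) ^ 2 - sin (x/2) ^ 2)) x := by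
  have h3 : √3 ^ 2 = 3 := sq_sqrt (by norm_num)
  rw [funext e1]
  refine HasDerivAt.congr_deriv ((((hS x).mul (hC x)).const_mul (2 * √3)).add (((hs x).mul (hc x)).const_mul 6)) ?_
  linear_combination -(-cosh (√3 * x / 2) ^ 2 - sinh (√3 * x / 2) ^ 2) * h3
lemma d2 (x : ℝ) : HasDerivAt c2 (-2 * √3 * 0 + √3 * (cos (x/2) * sinh (√3 * x / 2))
    + 3 * (sin (x/2) * cosh (√3 * x / 2)) - 3 * (sin (x/2) * cosh (√3 * x / 2))
    + 3 * √3 * (cos (x/2) * sinh (√3 * x / 2))) x := by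
  have h3 : √3 ^ 2 = 3 := sq_sqrt (by norm_num)
  have : c2 = fun x => 2 * √3 * (sin (x / 2) * sinh (√3 * x / 2)) +
        6 * (cos (x / 2) * cosh (√3 * x / 2)) := by ext; rw [c2]; ring
  rw [this]
  refine HasDerivAt.congr_deriv ((((hs x).mul (hS x)).const_mul (2 * √3)).add (((hc x).mul (hC x)).const_mul 6)) ?_
  linear_combination -(-sin (x/2) * cosh (√3 * x / 2)) * h3
lemma d3 (x : ℝ) : HasDerivAt c3 (-2 * √3 * (sin (x/2) * sinh (√3 * x / 2))
    + 6 * (cos (x/2) * cosh (√3 * x / 2))) x := by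
  have h3 : √3 ^ 2 = 3 := sq_sqrt (by norm_num)
  have : c3 = fun x => 4 * √3 * (cos (x / 2) * sinh (√3 * x / 2)) := by ext; rw [c3]; ring
  rw [this]
  refine HasDerivAt.congr_deriv ((((hc x).mul (hS x)).const_mul (4 * √3))) ?_
  linear_combination -(-2 * cos (x/2) * cosh (√3 * x / 2)) * h3
lemma d4 (x : ℝ) : HasDerivAt c4 (4 * √3 * (cos (x/2) * sinh (√3 * x / 2))
    - 4 * √3 * (cosh (√3 * x / 2) * sinh (√3 * x / 2))) x := by
  have h3 : √3 ^ 2 = 3 := sq_sqrt (by norm_num)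
  rw [funext e4]
  refine HasDerivAt.congr_deriv ((((((hc x).mul (hC x)).const_mul 6).add (((hs x).mul (hS x)).const_mul (2 * √3))).add_const 4).sub
    (((hC x).pow 2).const_mul 4)) ?_
  simp
  linear_combination -(-sin (x/2) * cosh (√3 * x / 2)) * h3

lemma closed_ode (x : ℝ) (hx : |x| < 1) :
    HasDerivAt (fun x => (c1 x / cD x, c2 x / cD x, c3 x / cD x, c4 x / cD x))
      (vf (c1 x / cD x, c2 x / cD x, c3 x / cD x, c4 x / cD x)) x := by
  have hD : cD x ≠ 0 := (D_pos x hx).ne'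
  have q : √3 ^ 2 = 3 := sq_sqrt (by norm_num)
  have hs : sin (x / 2) ^ 2 = 1 - cos (x / 2) ^ 2 := sin_sq _
  have hS : sinh (√3 * x / 2) ^ 2 = cosh (√3 * x / 2) ^ 2 - 1 := sinh_sq _
  have g1 := (d1 x).div (dD x) hD
  have g2 := (d2 x).div (dD x) hD
  have g3 := (d3 x).div (dD x) hD
  have g4 := (d4 x).div (dD x) hD
  refine HasDerivAt.congr_deriv (g1.prodMk (g2.prodMk (g3.prodMk g4))) ?_
  clear g1 g2 g3 g4
  have E2 : c2 x = 2 * √3 * sin (x / 2) * sinh (√3 * x / 2) +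
        6 * cos (x / 2) * cosh (√3 * x / 2) := rfl
  have E3 : c3 x = 4 * √3 * cos (x / 2) * sinh (√3 * x / 2) := rfl
  have ED := eD x
  have E1 := e1 x
  have E4 := e4 x
  simp only [vf]
  generalize cD x = D at *
  generalize c1 x = N1 at *
  generalize c2 x = N2 at *
  generalize c3 x = N3 at *
  generalize c4 x = N4 at *
  generalize sin (x/2) = s at *
  generalize cos (x/2) = c at *
  generalize sinh (√3 * x/2) = S at *
  generalize cosh (√3 * x/2) = C at *
  generalize √3 = k at *
  simp only [Prod.mk.injEq]
  refine ⟨?_, ?_, ?_, ?_⟩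
  · field_simp
    rw [E1, E2, ED]
    clear E1 E2 E3 E4 ED hD hx
    grind
  · field_simp
    rw [E1, E2, E3, ED]
    clear E1 E2 E3 E4 ED hD hx
    grind
  · field_simp
    rw [E4, E2, E3, ED]
    clear E1 E2 E3 E4 ED hD hx
    grind
  · field_simp
    rw [E1, E2, E3, E4, ED]
    clear E1 E2 E3 E4 ED hD hx
    grind

end analysis

lemma all_eq (x : ℝ) (hx : |x| < 1) :
    (ps fo x, ps fe x, ps go x, ps ge x) =
      (c1 x / cD x, c2 x / cD x, c3 x / cD x, c4 x / cD x) := by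
  have z : ∀ n : ℕ, |(fun _ => 0 : ℕ → ℝ) n| ≤ 1 := by simp
  have hz : ∀ t, ps (fun _ => 0) t = 0 := by intro t; simp [ps]
  refine ode_unique (fun x => (ps fo x, ps fe x, ps go x, ps ge x))
    (fun x => (c1 x / cD x, c2 x / cD x, c3 x / cD x, c4 x / cD x)) ?_ closed_ode ?_ x hx
  · intro t ht
    have h1 := ps_ode fo fe fe (fun _ => 0) (fun _ => 0) fo_le fe_le fe_le z z
      (fun n => by simpa using rec_fo n) t ht
    have h2 := ps_ode fe fe fo (fun _ => 0) go fe_le fe_le fo_le z go_le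
      (fun n => by simpa using rec_fe n) t ht
    have h3 := ps_ode go fe fe ge fe go_le fe_le fe_le ge_le fe_le rec_go t ht
    have h4 := ps_ode ge fe fo go go ge_le fe_le fo_le go_le go_le rec_ge t ht
    rw [hz, sub_zero] at h1 h2
    rw [add_zero] at h1
    exact h1.prodMk (h2.prodMk (h3.prodMk h4))
  · simp only [ps_zero, Prod.mk.injEq, c1, c2, c3, c4, cD]
    norm_num [fo, fe, go, ge, F_zero, G_zero]

lemma term_eq (p : Prop) [Decidable p] (n m : ℕ) (x : ℝ) :
    (if p then (m : ℝ) else 0) * x ^ n / n.factorial =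
      (if p then (m : ℝ) else 0) / n.factorial * x ^ n := by ring

end S5

/-- closed forms for `D(x)·F₁(x)`, `D(x)·F₂(x)`, `D(x)·G₁(x)`, `D(x)·G₂(x)`
where `D(x) = 3·cos x + 4 − cosh(√3·x)`, which is positive for `|x| < 1`. -/
theorem statement5 (x : ℝ) (hx : |x| < 1) :
    0 < 3 * Real.cos x + 4 - Real.cosh (Real.sqrt 3 * x) ∧
    Summable (fun n : ℕ => |(if n % 2 = 1 then (fCount n : ℝ) else 0) * x ^ n / n.factorial|) ∧
    Summable (fun n : ℕ => |(if n % 2 = 0 then (fCount n : ℝ) else 0) * x ^ n / n.factorial|) ∧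
    Summable (fun n : ℕ => |(if n % 2 = 1 then (gCount n : ℝ) else 0) * x ^ n / n.factorial|) ∧
    Summable (fun n : ℕ => |(if n % 2 = 0 then (gCount n : ℝ) else 0) * x ^ n / n.factorial|) ∧
    (3 * Real.cos x + 4 - Real.cosh (Real.sqrt 3 * x)) *
        (∑' n : ℕ, (if n % 2 = 1 then (fCount n : ℝ) else 0) * x ^ n / n.factorial) =
      Real.sqrt 3 * Real.sinh (Real.sqrt 3 * x) + 3 * Real.sin x ∧
    (3 * Real.cos x + 4 - Real.cosh (Real.sqrt 3 * x)) *
        (∑' n : ℕ, (if n % 2 = 0 then (fCount n : ℝ) else 0) * x ^ n / n.factorial) =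
      2 * Real.sqrt 3 * Real.sin (x / 2) * Real.sinh (Real.sqrt 3 * x / 2) +
        6 * Real.cos (x / 2) * Real.cosh (Real.sqrt 3 * x / 2) ∧
    (3 * Real.cos x + 4 - Real.cosh (Real.sqrt 3 * x)) *
        (∑' n : ℕ, (if n % 2 = 1 then (gCount n : ℝ) else 0) * x ^ n / n.factorial) =
      4 * Real.sqrt 3 * Real.cos (x / 2) * Real.sinh (Real.sqrt 3 * x / 2) ∧
    (3 * Real.cos x + 4 - Real.cosh (Real.sqrt 3 * x)) *
        (∑' n : ℕ, (if n % 2 = 0 then (gCount n : ℝ) else 0) * x ^ n / n.factorial) =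
      6 * Real.cos (x / 2) * Real.cosh (Real.sqrt 3 * x / 2) +
        2 * Real.sqrt 3 * Real.sin (x / 2) * Real.sinh (Real.sqrt 3 * x / 2) +
        2 - 2 * Real.cosh (Real.sqrt 3 * x) := by
  have H := S5.all_eq x hx
  simp only [Prod.mk.injEq] at H
  obtain ⟨h1, h2, h3, h4⟩ := H
  have hD : S5.cD x ≠ 0 := (S5.D_pos x hx).ne'
  simp only [S5.term_eq, S5.fCount_eq, S5.gCount_eq]
  refine ⟨S5.D_pos x hx, S5.summ S5.fo S5.fo_le x hx, S5.summ S5.fe S5.fe_le x hx,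
    S5.summ S5.go S5.go_le x hx, S5.summ S5.ge S5.ge_le x hx, ?_, ?_, ?_, ?_⟩
  · change S5.cD x * S5.ps S5.fo x = S5.c1 x
    rw [h1]; field_simp
  · change S5.cD x * S5.ps S5.fe x = S5.c2 x
    rw [h2]; field_simp
  · change S5.cD x * S5.ps S5.go x = S5.c3 x
    rw [h3]; field_simp
  · change S5.cD x * S5.ps S5.ge x = S5.c4 x
    rw [h4]; field_simp
end

section
/- Let D(z) = 3·cos(z/2) − √3·sinh(√3·z/2) for real z. Then: (i) there is a unique α ∈ (0,2) with D(α) = 0; and (ii) for this α there exists a constant C > 0 such that for all n ≥ 0, |f(n)/n! − 2/α^{n+1}| ≤ C·(0.305)ⁿ. In particular, αⁿ⁺¹·f(n)/n! → 2 as n → ∞. -/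
/-! ### Part 1: combinatorial recursion -/

/-- step `i` of the word `w` of length `n` is bad, with parity counted from the end -/
def badStep (n : ℕ) (w : ℕ → ℕ) (i : ℕ) : Prop :=
  if (n - i) % 2 = 1 then w (i + 1) < w i else w i < w (i + 1)

/-- no two consecutive bad steps -/
def goodEnd (n : ℕ) (w : ℕ → ℕ) : Prop :=
  ∀ i, 1 ≤ i → i + 1 < n → ¬ (badStep n w i ∧ badStep n w (i + 1))

def cntS : ℕ → Bool → ℕ → ℕ
  | 0, false, k => if k = 0 then 1 else 0
  | 0, true, _ => 0
  | n + 1, false, k =>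
      ∑ s ∈ Finset.range (n + 1), if n < k + s then cntS n false s + cntS n true s else 0
  | n + 1, true, k => ∑ s ∈ Finset.range (n + 1), if k + s ≤ n then cntS n false s else 0

def extFun {n : ℕ} (p : Fin (n + 1)) (τ : Equiv.Perm (Fin n)) : Fin (n + 1) → Fin (n + 1) :=
  Fin.snoc (α := fun _ => Fin (n + 1)) (fun i => p.succAbove (Fin.rev (τ i))) p

theorem extFun_inj {n : ℕ} (p : Fin (n + 1)) (τ : Equiv.Perm (Fin n)) :
    Function.Injective (extFun p τ) := by
  intro i j
  refine Fin.lastCases ?_ (fun i => ?_) i <;> refine Fin.lastCases ?_ (fun j => ?_) j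
  · simp
  · intro h
    simp only [extFun, Fin.snoc_last, Fin.snoc_castSucc] at h
    exact absurd h.symm (Fin.succAbove_ne _ _)
  · intro h
    simp only [extFun, Fin.snoc_last, Fin.snoc_castSucc] at h
    exact absurd h (Fin.succAbove_ne _ _)
  · intro h
    simp only [extFun, Fin.snoc_castSucc] at h
    have := Fin.succAbove_right_injective h
    have := Fin.rev_injective this
    rw [τ.injective this]

noncomputable def extPerm {n : ℕ} (p : Fin (n + 1)) (τ : Equiv.Perm (Fin n)) :
    Equiv.Perm (Fin (n + 1)) :=
  Equiv.ofBijective (extFun p τ) (Finite.injective_iff_bijective.1 (extFun_inj p τ))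

theorem extPerm_last {n : ℕ} (p : Fin (n + 1)) (τ : Equiv.Perm (Fin n)) :
    extPerm p τ (Fin.last n) = p := by
  simp [extPerm, extFun]

theorem extPerm_castSucc {n : ℕ} (p : Fin (n + 1)) (τ : Equiv.Perm (Fin n)) (i : Fin n) :
    extPerm p τ i.castSucc = p.succAbove (Fin.rev (τ i)) := by
  simp [extPerm, extFun]

theorem extPerm_bij (n : ℕ) : Function.Bijective
    (fun x : Fin (n + 1) × Equiv.Perm (Fin n) => extPerm x.1 x.2) := by
  rw [Fintype.bijective_iff_injective_and_card]
  constructor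
  · rintro ⟨p, τ⟩ ⟨q, ρ⟩ h
    simp only at h
    have h1 : p = q := by
      rw [← extPerm_last p τ, ← extPerm_last q ρ, h]
    subst h1
    have h2 : τ = ρ := by
      ext i
      have := extPerm_castSucc p τ i
      rw [h, extPerm_castSucc] at this
      have := Fin.rev_injective (Fin.succAbove_right_injective this)
      rw [this]
    rw [h2]
  · simp [Fintype.card_perm, Nat.factorial_succ]

theorem permEnt_ext_last {n : ℕ} (p : Fin (n + 1)) (τ : Equiv.Perm (Fin n)) :
    permEnt (extPerm p τ) (n + 1) = p + 1 := by
  have : (⟨n + 1 - 1, by omega⟩ : Fin (n + 1)) = Fin.last n := by ext; simp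
  simp only [permEnt]
  rw [dif_pos (by omega), this, extPerm_last]

theorem permEnt_le {n : ℕ} (τ : Equiv.Perm (Fin n)) {i : ℕ} (h1 : 1 ≤ i) (h2 : i ≤ n) :
    1 ≤ permEnt τ i ∧ permEnt τ i ≤ n := by
  simp only [permEnt]
  rw [dif_pos ⟨h1, h2⟩]
  have := (τ ⟨i - 1, by omega⟩).2
  omega

theorem permEnt_ext {n : ℕ} (p : Fin (n + 1)) (τ : Equiv.Perm (Fin n)) {i : ℕ}
    (h1 : 1 ≤ i) (h2 : i ≤ n) :
    permEnt (extPerm p τ) i =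
      if n - permEnt τ i < p then n - permEnt τ i + 1 else n - permEnt τ i + 2 := by
  have : (⟨i - 1, by omega⟩ : Fin (n + 1)) = Fin.castSucc (⟨i - 1, by omega⟩ : Fin n) := by
    ext; simp
  have e1 : permEnt τ i = τ ⟨i - 1, by omega⟩ + 1 := by
    simp only [permEnt]; rw [dif_pos ⟨h1, h2⟩]
  have e2 : permEnt (extPerm p τ) i = extPerm p τ ⟨i - 1, by omega⟩ + 1 := by
    simp only [permEnt]; rw [dif_pos (by omega)]
  rw [e1, e2, this, extPerm_castSucc]
  have h3 := (τ ⟨i - 1, by omega⟩).2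
  simp only [Fin.succAbove, Fin.lt_def, Fin.val_castSucc, Fin.val_rev]
  split_ifs <;> simp [Fin.val_rev]

theorem bad_ext {n : ℕ} (p : Fin (n + 1)) (τ : Equiv.Perm (Fin n)) {i : ℕ}
    (h1 : 1 ≤ i) (h2 : i < n) :
    badStep (n + 1) (permEnt (extPerm p τ)) i ↔ badStep n (permEnt τ) i := by
  have a1 := permEnt_le τ h1 h2.le
  have a2 := permEnt_le τ (i := i + 1) (by omega) (by omega)
  unfold badStep
  rw [permEnt_ext p τ h1 h2.le, permEnt_ext p τ (i := i + 1) (by omega) (by omega)]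
  split_ifs <;> omega

theorem bad_ext_last {n : ℕ} (p : Fin (n + 2)) (τ : Equiv.Perm (Fin (n + 1))) :
    badStep (n + 2) (permEnt (extPerm p τ)) (n + 1) ↔ (p : ℕ) + permEnt τ (n + 1) ≤ n + 1 := by
  have a1 := permEnt_le τ (i := n + 1) (by omega) le_rfl
  unfold badStep
  rw [permEnt_ext p τ (by omega) le_rfl, permEnt_ext_last]
  rw [if_pos (by omega)]
  split_ifs <;> omega

/-- the last step is bad -/
def badLast {n : ℕ} (τ : Equiv.Perm (Fin (n + 1))) : Prop :=
  1 ≤ n ∧ badStep (n + 1) (permEnt τ) n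

theorem good_ext {n : ℕ} (p : Fin (n + 2)) (τ : Equiv.Perm (Fin (n + 1))) :
    goodEnd (n + 2) (permEnt (extPerm p τ)) ↔
      goodEnd (n + 1) (permEnt τ) ∧ ¬ (badLast τ ∧ (p : ℕ) + permEnt τ (n + 1) ≤ n + 1) := by
  constructor
  · intro h
    refine ⟨fun i h1 h2 h3 => h i h1 (by omega) ?_, ?_⟩
    · rwa [bad_ext p τ h1 (by omega), bad_ext p τ (by omega) h2]
    · rintro ⟨⟨h1, h2⟩, h3⟩
      exact h n h1 (by omega) ⟨by rwa [bad_ext p τ h1 (by omega)], (bad_ext_last p τ).2 h3⟩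
  · rintro ⟨h, h'⟩ i h1 h2 ⟨h3, h4⟩
    rw [bad_ext p τ h1 (by omega)] at h3
    by_cases hi : i + 1 < n + 1
    · rw [bad_ext p τ (by omega) hi] at h4
      exact h i h1 hi ⟨h3, h4⟩
    · have : i = n := by omega
      subst this
      exact h' ⟨⟨h1, h3⟩, (bad_ext_last p τ).1 h4⟩

open Classical in
noncomputable def cset (n : ℕ) (b : Bool) (k : ℕ) : Finset (Equiv.Perm (Fin (n + 1))) :=
  Finset.univ.filter fun σ => goodEnd (n + 1) (permEnt σ) ∧ permEnt σ (n + 1) = k + 1 ∧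
    (badLast σ ↔ b = true)

open Classical in
theorem card_ext {n : ℕ} (P : Equiv.Perm (Fin (n + 1)) → Prop) (k : Fin (n + 1))
    (hP : ∀ σ, P σ → permEnt σ (n + 1) = k + 1) :
    (Finset.univ.filter P).card = (Finset.univ.filter fun τ => P (extPerm k τ)).card := by
  symm
  refine Finset.card_bij (fun τ _ => extPerm k τ) (by simp) ?_ ?_
  · intro τ _ ρ _ h
    have := (extPerm_bij n).1 (a₁ := (k, τ)) (a₂ := (k, ρ)) h
    simpa using this
  · intro σ hσ
    obtain ⟨⟨p, τ⟩, rfl⟩ := (extPerm_bij n).2 σ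
    simp only [Finset.mem_filter, Finset.mem_univ, true_and] at hσ
    have := hP _ hσ
    rw [permEnt_ext_last] at this
    have : p = k := by ext; omega
    subst this
    exact ⟨τ, by simpa using hσ, rfl⟩

open Classical in
theorem card_fib {n : ℕ} (P : Equiv.Perm (Fin (n + 1)) → Prop) :
    (Finset.univ.filter P).card = ∑ s ∈ Finset.range (n + 1),
      (Finset.univ.filter fun τ => P τ ∧ permEnt τ (n + 1) = s + 1).card := by
  rw [Finset.card_eq_sum_card_fiberwise (f := fun τ => permEnt τ (n + 1) - 1)
    (t := Finset.range (n + 1))]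
  · refine Finset.sum_congr rfl fun s _ => ?_
    rw [Finset.filter_filter]
    congr 1
    ext τ
    have := permEnt_le τ (i := n + 1) (by omega) le_rfl
    simp only [Finset.mem_filter, Finset.mem_univ, true_and]
    refine and_congr_right fun _ => ?_
    omega
  · intro τ _
    have := permEnt_le τ (i := n + 1) (by omega) le_rfl
    simp only [Finset.coe_range, Set.mem_Iio]
    omega

open Classical in
theorem card_both (n s : ℕ) :
    (Finset.univ.filter fun τ : Equiv.Perm (Fin (n + 1)) =>
      goodEnd (n + 1) (permEnt τ) ∧ permEnt τ (n + 1) = s + 1).card =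
      (cset n false s).card + (cset n true s).card := by
  unfold cset
  rw [← Finset.card_union_of_disjoint]
  · congr 1
    ext τ
    simp only [Finset.mem_filter, Finset.mem_univ, true_and, Finset.mem_union]
    by_cases h : badLast τ <;> simp [h]
  · rw [Finset.disjoint_filter]
    intro τ _ h h'
    have := h.2.2
    have := h'.2.2
    simp_all

theorem cset_card (n : ℕ) : ∀ (b : Bool) (k : ℕ), k ≤ n → (cset n b k).card = cntS n b k := by
  classical
  induction n with
  | zero =>
    intro b k hk
    obtain rfl : k = 0 := by omega
    have h1 : ∀ σ : Equiv.Perm (Fin 1), permEnt σ 1 = 1 := by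
      intro σ
      have := permEnt_le σ (i := 1) le_rfl le_rfl
      omega
    have h2 : ∀ σ : Equiv.Perm (Fin 1), goodEnd 1 (permEnt σ) := by
      intro σ i h1 h2
      omega
    cases b
    · simp [cset, cntS, h1, h2, badLast]
    · simp [cset, cntS, h1, h2, badLast]
  | succ n ih =>
    intro b k hk
    have key : ∀ τ : Equiv.Perm (Fin (n + 1)),
        (goodEnd (n + 1 + 1) (permEnt (extPerm (⟨k, by omega⟩ : Fin (n + 2)) τ)) ∧
        permEnt (extPerm (⟨k, by omega⟩ : Fin (n + 2)) τ) (n + 1 + 1) = k + 1 ∧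
        (badLast (extPerm (⟨k, by omega⟩ : Fin (n + 2)) τ) ↔ b = true)) ↔
        (goodEnd (n + 1) (permEnt τ) ∧ ¬ (badLast τ ∧ k + permEnt τ (n + 1) ≤ n + 1)) ∧
        (k + permEnt τ (n + 1) ≤ n + 1 ↔ b = true) := by
      intro τ
      have := good_ext (⟨k, by omega⟩ : Fin (n + 2)) τ
      have h2 := bad_ext_last (⟨k, by omega⟩ : Fin (n + 2)) τ
      have h3 : badLast (extPerm (⟨k, by omega⟩ : Fin (n + 2)) τ) ↔
          k + permEnt τ (n + 1) ≤ n + 1 := by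
        rw [badLast, h2]; simp
      rw [this, permEnt_ext_last, h3]
      simp
    have e1 : (cset (n + 1) b k).card = ∑ s ∈ Finset.range (n + 1),
      (Finset.univ.filter fun τ : Equiv.Perm (Fin (n + 1)) =>
        ((goodEnd (n + 1) (permEnt τ) ∧ ¬ (badLast τ ∧ k + permEnt τ (n + 1) ≤ n + 1)) ∧
        (k + permEnt τ (n + 1) ≤ n + 1 ↔ b = true)) ∧ permEnt τ (n + 1) = s + 1).card := by
      have e0 := card_ext (fun σ : Equiv.Perm (Fin (n + 2)) =>
        goodEnd (n + 1 + 1) (permEnt σ) ∧ permEnt σ (n + 1 + 1) = k + 1 ∧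
        (badLast σ ↔ b = true)) (⟨k, by omega⟩ : Fin (n + 2)) (fun σ h => h.2.1)
      simp_rw [key] at e0
      refine Eq.trans (Eq.trans ?_ e0) ?_
      · unfold cset; congr!
      convert card_fib (fun τ : Equiv.Perm (Fin (n + 1)) =>
        (goodEnd (n + 1) (permEnt τ) ∧ ¬ (badLast τ ∧ k + permEnt τ (n + 1) ≤ n + 1)) ∧
        (k + permEnt τ (n + 1) ≤ n + 1 ↔ b = true))
    rw [e1]
    cases b
    · rw [cntS]
      refine Finset.sum_congr rfl fun s hs => ?_
      have hs' : s ≤ n := by simpa [Nat.lt_succ_iff] using hs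
      rw [← ih false s hs', ← ih true s hs', ← card_both]
      split_ifs with h
      · congr 1
        ext τ
        simp only [Finset.mem_filter, Finset.mem_univ, true_and]
        constructor
        · tauto
        · rintro ⟨h1, h2⟩
          rw [h2]
          have : ¬ (k + (s + 1) ≤ n + 1) := by omega
          simp [h1, this]
      · rw [Finset.card_eq_zero, Finset.filter_eq_empty_iff]
        rintro τ _ ⟨⟨_, h1⟩, h2⟩
        rw [h2] at h1
        have : (k + (s + 1) ≤ n + 1) := by omega
        simp [this] at h1
    · rw [cntS]
      refine Finset.sum_congr rfl fun s hs => ?_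
      have hs' : s ≤ n := by simpa [Nat.lt_succ_iff] using hs
      rw [← ih false s hs', cset]
      split_ifs with h
      · congr 1
        ext τ
        simp only [Finset.mem_filter, Finset.mem_univ, true_and]
        have h3 : (k + (s + 1) ≤ n + 1) := by omega
        constructor
        · rintro ⟨⟨⟨h1, h2⟩, _⟩, h4⟩
          rw [h4] at h2
          simp [h1, h4]
          tauto
        · rintro ⟨h1, h2, h4⟩
          rw [h2]
          simp at h4
          simp [h1, h4, h3]
      · rw [Finset.card_eq_zero, Finset.filter_eq_empty_iff]
        rintro τ _ ⟨⟨_, h1⟩, h2⟩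
        rw [h2] at h1
        have : ¬ (k + (s + 1) ≤ n + 1) := by omega
        simp [this] at h1

theorem goodPerm_iff_odd {n : ℕ} (σ : Equiv.Perm (Fin n)) (hn : n % 2 = 1) :
    GoodPerm σ ↔ goodEnd n (permEnt σ) := by
  constructor
  · rintro ⟨h1, h2⟩ i hi hi' ⟨h3, h4⟩
    unfold badStep at h3 h4
    by_cases hp : (n - i) % 2 = 1
    · rw [if_pos hp] at h3
      rw [if_neg (by omega)] at h4
      have := h1 (i + 1) ⟨by omega, hi', by simpa using h3, h4⟩
      omega
    · rw [if_neg hp] at h3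
      rw [if_pos (by omega)] at h4
      have := h2 (i + 1) ⟨by omega, hi', by simpa using h3, h4⟩
      omega
  · intro h
    constructor
    · rintro i ⟨h1, h2, h3, h4⟩
      by_contra hc
      obtain ⟨j, rfl⟩ : ∃ j, i = j + 1 := ⟨i - 1, by omega⟩
      refine h j (by omega) h2 ⟨?_, ?_⟩
      · unfold badStep
        rw [if_pos (by omega)]; simpa using h3
      · unfold badStep
        rw [if_neg (by omega)]; exact h4
    · rintro i ⟨h1, h2, h3, h4⟩
      by_contra hc
      obtain ⟨j, rfl⟩ : ∃ j, i = j + 1 := ⟨i - 1, by omega⟩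
      refine h j (by omega) h2 ⟨?_, ?_⟩
      · unfold badStep
        rw [if_neg (by omega)]; simpa using h3
      · unfold badStep
        rw [if_pos (by omega)]; exact h4

theorem permEnt_rev {n : ℕ} (σ : Equiv.Perm (Fin n)) {i : ℕ} (h1 : 1 ≤ i) (h2 : i ≤ n) :
    permEnt (Fin.revPerm * σ) i = n + 1 - permEnt σ i := by
  simp only [permEnt]
  rw [dif_pos (by omega), dif_pos (by omega)]
  have h3 := (σ ⟨i - 1, by omega⟩).2
  simp [Fin.val_rev]
  omega

theorem goodPerm_iff_even {n : ℕ} (σ : Equiv.Perm (Fin n)) (hn : n % 2 = 0) :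
    GoodPerm σ ↔ goodEnd n (permEnt (Fin.revPerm * σ)) := by
  have key : ∀ i, 1 ≤ i → i < n → (badStep n (permEnt (Fin.revPerm * σ)) i ↔
      if (n - i) % 2 = 1 then permEnt σ i < permEnt σ (i + 1) else
        permEnt σ (i + 1) < permEnt σ i) := by
    intro i h1 h2
    unfold badStep
    have a1 := permEnt_le σ h1 h2.le
    have a2 := permEnt_le σ (i := i + 1) (by omega) (by omega)
    rw [permEnt_rev σ h1 h2.le, permEnt_rev σ (i := i + 1) (by omega) (by omega)]
    split_ifs <;> omega
  constructor
  · rintro ⟨h1, h2⟩ i hi hi' ⟨h3, h4⟩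
    rw [key _ (by omega) (by omega)] at h3 h4
    by_cases hp : (n - i) % 2 = 1
    · rw [if_pos hp] at h3
      rw [if_neg (by omega)] at h4
      have := h2 (i + 1) ⟨by omega, hi', by simpa using h3, h4⟩
      omega
    · rw [if_neg hp] at h3
      rw [if_pos (by omega)] at h4
      have := h1 (i + 1) ⟨by omega, hi', by simpa using h3, h4⟩
      omega
  · intro h
    constructor
    · rintro i ⟨h1, h2, h3, h4⟩
      by_contra hc
      obtain ⟨j, rfl⟩ : ∃ j, i = j + 1 := ⟨i - 1, by omega⟩
      refine h j (by omega) h2 ⟨?_, ?_⟩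
      · rw [key _ (by omega) (by omega), if_neg (by omega)]; simpa using h3
      · rw [key _ (by omega) (by omega), if_pos (by omega)]; exact h4
    · rintro i ⟨h1, h2, h3, h4⟩
      by_contra hc
      obtain ⟨j, rfl⟩ : ∃ j, i = j + 1 := ⟨i - 1, by omega⟩
      refine h j (by omega) h2 ⟨?_, ?_⟩
      · rw [key _ (by omega) (by omega), if_pos (by omega)]; simpa using h3
      · rw [key _ (by omega) (by omega), if_neg (by omega)]; exact h4

theorem fCount_eq_good (n : ℕ) :
    fCount n = Nat.card {σ : Equiv.Perm (Fin n) // goodEnd n (permEnt σ)} := by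
  unfold fCount
  rcases Nat.mod_two_eq_zero_or_one n with h | h
  · exact Nat.card_congr (Equiv.subtypeEquiv (Equiv.mulLeft Fin.revPerm)
      (fun σ => goodPerm_iff_even σ h))
  · exact Nat.card_congr (Equiv.subtypeEquivRight (fun σ => goodPerm_iff_odd σ h))

theorem fCount_eq (n : ℕ) : fCount n = cntS n false n := by
  classical
  cases n with
  | zero =>
    have h2 : ∀ σ : Equiv.Perm (Fin 0), goodEnd 0 (permEnt σ) := by
      intro σ i h1 h2
      omega
    rw [fCount_eq_good]
    simp [h2, cntS]
  | succ n =>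
    rw [fCount_eq_good, Nat.card_eq_fintype_card, Fintype.card_subtype, card_fib, cntS]
    refine Finset.sum_congr rfl fun s hs => ?_
    have hs' : s ≤ n := by simpa [Nat.lt_succ_iff] using hs
    rw [card_both, cset_card n _ _ hs', cset_card n _ _ hs', if_pos (by omega)]

/-! ### Part 2: binomial recursions and generating functions -/

theorem cnt_false_step (n k : ℕ) (hk : k ≤ n) : cntS (n + 1) false (k + 1) =
    cntS (n + 1) false k + (cntS n false (n - k) + cntS n true (n - k)) := by
  rw [cntS, cntS]
  have : ∀ s ∈ Finset.range (n + 1),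
      (if n < k + 1 + s then cntS n false s + cntS n true s else 0) =
      (if n < k + s then cntS n false s + cntS n true s else 0) +
      (if s = n - k then cntS n false s + cntS n true s else 0) := by
    intro s hs
    have hs' : s ≤ n := by simpa [Nat.lt_succ_iff] using hs
    by_cases h1 : n < k + s
    · rw [if_pos h1, if_pos (by omega), if_neg (by omega)]; omega
    · by_cases h2 : s = n - k
      · rw [if_neg h1, if_pos (by omega), if_pos h2]; omega
      · rw [if_neg h1, if_neg (by omega), if_neg h2]
  rw [Finset.sum_congr rfl this, Finset.sum_add_distrib, Finset.sum_ite_eq', if_pos]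
  simp

theorem cnt_true_step (n k : ℕ) (hk : k ≤ n) : cntS (n + 1) true k =
    cntS (n + 1) true (k + 1) + cntS n false (n - k) := by
  rw [cntS, cntS]
  have : ∀ s ∈ Finset.range (n + 1),
      (if k + s ≤ n then cntS n false s else 0) =
      (if k + 1 + s ≤ n then cntS n false s else 0) +
      (if s = n - k then cntS n false s else 0) := by
    intro s hs
    have hs' : s ≤ n := by simpa [Nat.lt_succ_iff] using hs
    by_cases h1 : k + 1 + s ≤ n
    · rw [if_pos h1, if_pos (by omega), if_neg (by omega)]; omega
    · by_cases h2 : s = n - k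
      · rw [if_neg h1, if_pos (by omega), if_pos h2]; omega
      · rw [if_neg h1, if_neg (by omega), if_neg h2]
  rw [Finset.sum_congr rfl this, Finset.sum_add_distrib, Finset.sum_ite_eq', if_pos]
  simp

theorem cnt_true_top (n : ℕ) : cntS n true n = 0 := by
  cases n with
  | zero => rfl
  | succ n =>
    rw [cntS]
    refine Finset.sum_eq_zero fun s _ => if_neg (by omega)

theorem cnt_false_zero (n : ℕ) : cntS n false 0 = if n = 0 then 1 else 0 := by
  cases n with
  | zero => rfl
  | succ n =>
    rw [cntS, if_neg (by omega)]
    refine Finset.sum_eq_zero fun s hs => if_neg ?_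
    have hs' : s ≤ n := by simpa [Nat.lt_succ_iff] using hs
    omega

theorem cnt_le (n : ℕ) : ∀ k, cntS n false k + cntS n true k ≤ n.factorial := by
  induction n with
  | zero => intro k; simp only [cntS]; split_ifs <;> simp
  | succ n ih =>
    intro k
    rw [cntS, cntS, ← Finset.sum_add_distrib]
    calc _ ≤ ∑ s ∈ Finset.range (n + 1), n.factorial := by
          refine Finset.sum_le_sum fun s _ => ?_
          have := ih s
          split_ifs <;> omega
      _ = _ := by simp [Nat.factorial_succ]

noncomputable def yy (μ : ℂ) (n k : ℕ) : ℂ := cntS n false k + μ ^ 2 * cntS n true k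

noncomputable def ff (n : ℕ) : ℂ := (cntS n false n : ℂ)

noncomputable def cc (n : ℕ) : ℂ := (cntS n true 0 : ℂ)

noncomputable def ee (μ : ℂ) (n : ℕ) : ℂ := (if n = 0 then 1 else 0) + μ ^ 2 * cc n

theorem yy_step (μ : ℂ) (n k : ℕ) (hk : k ≤ n) : yy μ (n + 1) (k + 1) - yy μ (n + 1) k =
    (1 - μ ^ 2) * cntS n false (n - k) + cntS n true (n - k) := by
  unfold yy
  rw [cnt_false_step n k hk, cnt_true_step n k hk]
  push_cast
  ring

theorem yy_step2 (μ : ℂ) (hμ : μ ^ 4 - μ ^ 2 + 1 = 0) (m k : ℕ) (hk : k ≤ m) :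
    (yy μ (m + 2) (k + 2) - yy μ (m + 2) (k + 1)) - (yy μ (m + 2) (k + 1) - yy μ (m + 2) k) =
      μ ^ 2 * yy μ m k := by
  rw [yy_step μ (m + 1) (k + 1) (by omega), yy_step μ (m + 1) k (by omega)]
  have e1 : m + 1 - (k + 1) = m - k := by omega
  have e2 : m + 1 - k = m - k + 1 := by omega
  have e3 : m - (m - k) = k := by omega
  rw [e1, e2, cnt_false_step m (m - k) (by omega), cnt_true_step m (m - k) (by omega), e3]
  unfold yy
  push_cast
  linear_combination (-(cntS m true k : ℂ)) * hμ

theorem fwd_congr (j : ℕ) : ∀ (x y : ℕ → ℂ) (k : ℕ), (∀ i, i ≤ j → x (k + i) = y (k + i)) →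
    (fwdDiff 1)^[j] x k = (fwdDiff 1)^[j] y k := by
  induction j with
  | zero => intro x y k h; simpa using h 0 le_rfl
  | succ j ih =>
    intro x y k h
    rw [Function.iterate_succ_apply, Function.iterate_succ_apply]
    refine ih _ _ _ fun i hi => ?_
    have h1 := h i (by omega)
    have h2 := h (i + 1) (by omega)
    rw [← add_assoc] at h2
    simp only [fwdDiff, h1, h2]

noncomputable def chc (μ : ℂ) (j : ℕ) : ℂ := (μ ^ j + (-μ) ^ j) / 2
noncomputable def shc (μ : ℂ) (j : ℕ) : ℂ := (μ ^ j - (-μ) ^ j) / 2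

theorem yy_iter (μ : ℂ) (hμ : μ ^ 4 - μ ^ 2 + 1 = 0) (j : ℕ) : ∀ n, j ≤ n →
    (fwdDiff 1)^[j] (yy μ n) 0 = chc μ j * ee μ (n - j) - μ ^ 3 * shc μ j * ff (n - j) := by
  induction j using Nat.strong_induction_on with
  | _ j ih =>
    intro n hn
    match j, ih with
    | 0, ih =>
      simp [chc, shc, yy, ee, cc, cnt_false_zero]
    | 1, ih =>
      obtain ⟨m, rfl⟩ : ∃ m, n = m + 1 := ⟨n - 1, by omega⟩
      have := yy_step μ m 0 (by omega)
      simp only [Function.iterate_one, fwdDiff]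
      rw [this]
      simp only [Nat.sub_zero, cnt_true_top, chc, shc, ff, Nat.add_sub_cancel]
      push_cast
      linear_combination (cntS m false m : ℂ) * hμ
    | j + 2, ih =>
      obtain ⟨m, rfl⟩ : ∃ m, n = m + 2 := ⟨n - 2, by omega⟩
      rw [Function.iterate_succ_apply, Function.iterate_succ_apply]
      rw [fwd_congr j _ (μ ^ 2 • yy μ m) 0, fwdDiff_iter_const_smul, Pi.smul_apply, ih j (by omega) m (by omega)]
      · have e : m + 2 - (j + 2) = m - j := by omega
        rw [e]
        simp only [chc, shc, smul_eq_mul, pow_add]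
        ring
      · intro i hi
        have := yy_step2 μ hμ m i (by omega)
        simp only [fwdDiff, zero_add, Pi.smul_apply, smul_eq_mul]
        exact this

theorem ff_rec (μ : ℂ) (hμ : μ ^ 4 - μ ^ 2 + 1 = 0) (n : ℕ) :
    ff n = ∑ j ∈ Finset.range (n + 1), (n.choose j : ℂ) * (chc μ j * ee μ (n - j)) +
      ∑ j ∈ Finset.range (n + 1), (n.choose j : ℂ) * ((-μ ^ 3 * shc μ j) * ff (n - j)) := by
  have h := shift_eq_sum_fwdDiff_iter (1 : ℕ) (yy μ n) n 0
  have h0 : yy μ n (0 + n • 1) = ff n := by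
    simp [yy, ff, cnt_true_top]
  rw [h0] at h
  rw [h, ← Finset.sum_add_distrib]
  refine Finset.sum_congr rfl fun j hj => ?_
  have hj' : j ≤ n := by simpa [Nat.lt_succ_iff] using hj
  rw [yy_iter μ hμ j n hj']
  simp only [nsmul_eq_mul]
  ring

theorem hasSum_congr_aux {f g : ℕ → ℂ} {a : ℂ} (h : ∀ n, f n = g n) : HasSum f a ↔ HasSum g a := by
  rw [funext h]

theorem egf_mul (a b : ℕ → ℂ) (z : ℂ) (ha : Summable fun n => ‖a n * z ^ n / n.factorial‖)
    (hb : Summable fun n => ‖b n * z ^ n / n.factorial‖) :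
    HasSum (fun n => (∑ j ∈ Finset.range (n + 1), (n.choose j : ℂ) * (a j * b (n - j))) *
      z ^ n / n.factorial)
      ((∑' n, a n * z ^ n / n.factorial) * (∑' n, b n * z ^ n / n.factorial)) := by
  rw [tsum_mul_tsum_eq_tsum_sum_range_of_summable_norm ha hb]
  have hs := (summable_norm_sum_mul_range_of_summable_norm ha hb).of_norm
  refine (hasSum_congr_aux fun n => ?_).mpr hs.hasSum
  rw [Finset.sum_mul, Finset.sum_div]
  refine Finset.sum_congr rfl fun j hj => ?_
  have hj' : j ≤ n := by simpa [Nat.lt_succ_iff] using hj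
  have h1 : ((n.choose j : ℂ)) * j.factorial * (n - j).factorial = n.factorial := by
    exact_mod_cast Nat.choose_mul_factorial_mul_factorial hj'
  have h2 : (j.factorial : ℂ) ≠ 0 := by exact_mod_cast j.factorial_ne_zero
  have h3 : ((n - j).factorial : ℂ) ≠ 0 := by exact_mod_cast (n - j).factorial_ne_zero
  have h4 : z ^ n = z ^ j * z ^ (n - j) := by rw [← pow_add]; congr 1; omega
  have h5 : (n.factorial : ℂ) ≠ 0 := by exact_mod_cast n.factorial_ne_zero
  rw [h4]
  field_simp
  linear_combination (a j * b (n - j) * z ^ j * z ^ (n - j)) * h1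

theorem exp_hasSum (μ z : ℂ) : HasSum (fun n : ℕ => μ ^ n * z ^ n / n.factorial)
    (Complex.exp (μ * z)) := by
  have := NormedSpace.expSeries_div_hasSum_exp (𝔸 := ℂ) (μ * z)
  rw [← Complex.exp_eq_exp_ℂ] at this
  simpa [mul_pow] using this

theorem ch_hasSum (μ z : ℂ) : HasSum (fun n : ℕ => chc μ n * z ^ n / n.factorial)
    (Complex.cosh (μ * z)) := by
  have := ((exp_hasSum μ z).add (exp_hasSum (-μ) z)).div_const 2
  rw [Complex.cosh]
  rw [neg_mul] at this
  refine (hasSum_congr_aux fun n => ?_).mpr this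
  simp only [chc]; ring

theorem sh_hasSum (μ z : ℂ) : HasSum (fun n : ℕ => (-μ ^ 3 * shc μ n) * z ^ n / n.factorial)
    (-μ ^ 3 * Complex.sinh (μ * z)) := by
  have := (((exp_hasSum μ z).sub (exp_hasSum (-μ) z)).div_const 2).mul_left (-μ ^ 3)
  rw [Complex.sinh]
  rw [neg_mul μ] at this
  refine (hasSum_congr_aux fun n => ?_).mpr this
  simp only [shc]; ring

theorem summable_of_le (a : ℕ → ℂ) (C : ℝ) (ha : ∀ n, ‖a n‖ ≤ C * n.factorial) (z : ℂ)
    (hz : ‖z‖ < 1) : Summable fun n => ‖a n * z ^ n / n.factorial‖ := by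
  refine Summable.of_nonneg_of_le (fun _ => norm_nonneg _) (fun n => ?_)
    ((summable_geometric_of_lt_one (norm_nonneg z) hz).mul_left C)
  rw [norm_div, norm_mul, norm_pow, Complex.norm_natCast]
  have : (0 : ℝ) < n.factorial := by exact_mod_cast n.factorial_pos
  rw [div_le_iff₀ this]
  have := mul_le_mul_of_nonneg_right (ha n) (pow_nonneg (norm_nonneg z) n)
  linarith

theorem ff_norm (n : ℕ) : ‖ff n‖ ≤ 1 * n.factorial := by
  unfold ff
  rw [Complex.norm_natCast, one_mul]
  exact_mod_cast (le_trans (Nat.le_add_right _ _) (cnt_le n n))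

theorem cc_norm (n : ℕ) : ‖cc n‖ ≤ 1 * n.factorial := by
  unfold cc
  rw [Complex.norm_natCast, one_mul]
  exact_mod_cast (le_trans (Nat.le_add_left _ _) (cnt_le n 0))

noncomputable def FF (z : ℂ) : ℂ := ∑' n, ff n * z ^ n / n.factorial
noncomputable def CC (z : ℂ) : ℂ := ∑' n, cc n * z ^ n / n.factorial

theorem FF_hasSum (z : ℂ) (hz : ‖z‖ < 1) : HasSum (fun n => ff n * z ^ n / n.factorial) (FF z) :=
  (summable_of_le ff 1 ff_norm z hz).of_norm.hasSum

theorem CC_hasSum (z : ℂ) (hz : ‖z‖ < 1) : HasSum (fun n => cc n * z ^ n / n.factorial) (CC z) :=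
  (summable_of_le cc 1 cc_norm z hz).of_norm.hasSum

theorem ee_hasSum (μ z : ℂ) (hz : ‖z‖ < 1) :
    HasSum (fun n => ee μ n * z ^ n / n.factorial) (1 + μ ^ 2 * CC z) := by
  have h1 : HasSum (fun n : ℕ => if n = 0 then (1 : ℂ) else 0) 1 := hasSum_ite_eq 0 1
  have := h1.add ((CC_hasSum z hz).mul_left (μ ^ 2))
  refine (hasSum_congr_aux fun n => ?_).mpr this
  unfold ee
  split_ifs with h
  · subst h; simp
  · ring

theorem FF_eq (μ : ℂ) (hμ : μ ^ 4 - μ ^ 2 + 1 = 0) (z : ℂ) (hz : ‖z‖ < 1) :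
    FF z = Complex.cosh (μ * z) * (1 + μ ^ 2 * CC z) - μ ^ 3 * Complex.sinh (μ * z) * FF z := by
  have h1 := egf_mul (chc μ) (ee μ) z (ch_hasSum μ z).summable.norm (ee_hasSum μ z hz).summable.norm
  have h2 := egf_mul (fun n => -μ ^ 3 * shc μ n) ff z (sh_hasSum μ z).summable.norm
    (FF_hasSum z hz).summable.norm
  rw [(ch_hasSum μ z).tsum_eq, (ee_hasSum μ z hz).tsum_eq] at h1
  rw [(sh_hasSum μ z).tsum_eq, (FF_hasSum z hz).tsum_eq] at h2
  have h3 := h1.add h2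
  have h4 := FF_hasSum z hz
  have h5 : (fun n => ff n * z ^ n / n.factorial) = fun n : ℕ =>
      (∑ j ∈ Finset.range (n + 1), (n.choose j : ℂ) * (chc μ j * ee μ (n - j))) *
      z ^ n / n.factorial + (∑ j ∈ Finset.range (n + 1), (n.choose j : ℂ) *
        ((-μ ^ 3 * shc μ j) * ff (n - j))) * z ^ n / n.factorial := by
    funext n
    rw [ff_rec μ hμ n]
    ring
  rw [h5] at h4
  linear_combination h4.unique h3

/-! ### Part 3: the zeros of `D` in the disc -/

def ladd : List ℤ → List ℤ → List ℤ
  | [], m => m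
  | a :: l, [] => a :: l
  | a :: l, b :: m => (a + b) :: ladd l m

def lscale (a : ℤ) : List ℤ → List ℤ
  | [] => []
  | b :: m => (a * b) :: lscale a m

def lmul : List ℤ → List ℤ → List ℤ
  | [], _ => []
  | a :: l, m => ladd (lscale a m) (0 :: lmul l m)

def lnorm : List ℤ → ℕ
  | [] => 0
  | a :: l => a.natAbs + lnorm l

noncomputable def leval : List ℤ → ℂ → ℂ
  | [], _ => 0
  | a :: l, w => a + w * leval l w

theorem leval_ladd (l m : List ℤ) (w : ℂ) : leval (ladd l m) w = leval l w + leval m w := by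
  induction l generalizing m with
  | nil => simp [ladd, leval]
  | cons a l ih =>
    cases m with
    | nil => simp [ladd, leval]
    | cons b m => simp only [ladd, leval, ih]; push_cast; ring

theorem leval_lscale (a : ℤ) (m : List ℤ) (w : ℂ) : leval (lscale a m) w = a * leval m w := by
  induction m with
  | nil => simp [lscale, leval]
  | cons b m ih => simp only [lscale, leval, ih]; push_cast; ring

theorem leval_lmul (l m : List ℤ) (w : ℂ) : leval (lmul l m) w = leval l w * leval m w := by
  induction l with
  | nil => simp [lmul, leval]
  | cons a l ih =>
    simp only [lmul, leval_ladd, leval_lscale, leval, ih]; push_cast; ring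

theorem leval_norm (l : List ℤ) (w : ℂ) (hw : ‖w‖ ≤ 1) : ‖leval l w‖ ≤ lnorm l := by
  induction l with
  | nil => simp [leval, lnorm]
  | cons a l ih =>
    simp only [leval, lnorm]
    refine (norm_add_le _ _).trans ?_
    push_cast
    refine add_le_add (by simp) ?_
    rw [norm_mul]
    calc ‖w‖ * ‖leval l w‖ ≤ 1 * ‖leval l w‖ := by gcongr
      _ ≤ _ := by simpa using ih

theorem leval_sum (l : List ℤ) (w : ℂ) :
    leval l w = ∑ k ∈ Finset.range l.length, (l.getD k 0 : ℂ) * w ^ k := by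
  induction l with
  | nil => simp [leval]
  | cons a l ih =>
    rw [List.length_cons, Finset.sum_range_succ']
    simp only [leval, ih, List.getD_cons_succ, List.getD_cons_zero, pow_zero, mul_one]
    rw [Finset.mul_sum, add_comm]
    congr 1
    refine Finset.sum_congr rfl fun k _ => ?_
    ring

def tauL : List ℤ := [30000000000000, -49180327868852, -40311744154797, -66084826483274,
  9027981760010, -26639946177079, -808741535430, -5113822355181, 38811645076, -572630828986,
  -1158937116, -41970449951, 23595342, -2169105180, -348414, -83276584, 3901, -2468400, -34,
  -58190, 0, -1117, 0, -18]

def pL : List ℤ := [333333333333, 124068859445, -70871625656, -55794594627, -13707116777,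
  5101788463, 7525657783, 3019575197, -312614610, -967358237, -496187101, -36292251, 114144464,
  77540451, 15235288, -11840918, -11191627, -3465821, 965834, 1512469, 639746, -27991, -189811,
  -105511, -11500, 21696, 16038, 3685, -2144, -2274, -775, 154, 301, 138, 1, -37, -22, -3, 4, 3, 1]

def linL : List ℤ := [10 ^ 11, -252240121536]

def quadL : List ℤ := [10 ^ 22, 2 * 62763176570 * 10 ^ 11, 62763176570 ^ 2 + 77835867257 ^ 2]

theorem cert1 : lnorm (ladd (lscale (10 ^ 8) (lmul tauL pL)) (lscale (-1) (lmul linL quadL))) ≤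
    2 * 10 ^ 23 := by decide +kernel

theorem cert2 : lnorm pL ≤ 7 * 10 ^ 11 := by decide +kernel

/-- The function `D`. -/
noncomputable def DD (z : ℂ) : ℂ :=
  3 * Complex.cos (z / 2) - (Real.sqrt 3 : ℂ) * Complex.sinh ((Real.sqrt 3 : ℂ) * z / 2)

theorem sqrt3_sq : (Real.sqrt 3 : ℂ) ^ 2 = 3 := by
  rw [← Complex.ofReal_pow, Real.sq_sqrt (by norm_num)]; norm_num

noncomputable def dk (k : ℕ) : ℝ :=
  (if k % 2 = 0 then 3 * (-1 / 4) ^ (k / 2) else -(3 / 2) * (3 / 4) ^ (k / 2)) / k.factorial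

theorem dk_eq (k : ℕ) (z : ℂ) : (dk k : ℂ) * z ^ k =
    3 / 2 * ((Complex.I * (z / 2)) ^ k / k.factorial + (-(Complex.I * (z / 2))) ^ k / k.factorial) -
    (Real.sqrt 3 : ℂ) / 2 * (((Real.sqrt 3 : ℂ) * z / 2) ^ k / k.factorial -
      (-((Real.sqrt 3 : ℂ) * z / 2)) ^ k / k.factorial) := by
  have h3 := sqrt3_sq
  have hI := Complex.I_sq
  have hf : (k.factorial : ℂ) ≠ 0 := by exact_mod_cast k.factorial_ne_zero
  rcases Nat.even_or_odd' k with ⟨j, hj | hj⟩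
  · have e1 : k % 2 = 0 := by omega
    have e2 : k / 2 = j := by omega
    have e3 : ∀ x : ℂ, x ^ k = (x ^ 2) ^ j := fun x => by rw [hj, pow_mul]
    unfold dk
    rw [if_pos e1, e2]
    push_cast
    simp only [e3, neg_sq]
    have : (Complex.I * (z / 2)) ^ 2 = (-1 / 4) * z ^ 2 := by rw [mul_pow, hI]; ring
    rw [this, mul_pow]
    ring
  · have e1 : ¬ k % 2 = 0 := by omega
    have e2 : k / 2 = j := by omega
    have e3 : ∀ x : ℂ, x ^ k = (x ^ 2) ^ j * x := fun x => by rw [hj, pow_succ, pow_mul]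
    unfold dk
    rw [if_neg e1, e2]
    push_cast
    simp only [e3, neg_sq]
    have : ((Real.sqrt 3 : ℂ) * z / 2) ^ 2 = (3 / 4) * z ^ 2 := by rw [div_pow, mul_pow, h3]; ring
    rw [this, mul_pow]
    linear_combination ((1 / 2) * ((3 / 4) ^ j * (z ^ 2) ^ j * z / k.factorial)) * h3

theorem DD_exp (z : ℂ) : DD z =
    3 / 2 * (Complex.exp (Complex.I * (z / 2)) + Complex.exp (-(Complex.I * (z / 2)))) -
    (Real.sqrt 3 : ℂ) / 2 * (Complex.exp ((Real.sqrt 3 : ℂ) * z / 2) -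
      Complex.exp (-((Real.sqrt 3 : ℂ) * z / 2))) := by
  unfold DD
  rw [Complex.cos, Complex.sinh, neg_mul, mul_comm (z / 2)]
  ring

theorem DD_taylor (z : ℂ) (hz : ‖z‖ ≤ 200 / 61) :
    ‖DD z - ∑ k ∈ Finset.range 24, (dk k : ℂ) * z ^ k‖ ≤ 1 / 10 ^ 12 := by
  have h3 : ‖(Real.sqrt 3 : ℂ)‖ = Real.sqrt 3 := by
    rw [Complex.norm_real, Real.norm_of_nonneg (Real.sqrt_nonneg _)]
  have h32 : Real.sqrt 3 ≤ 2 := by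
    rw [Real.sqrt_le_left (by norm_num)]; norm_num
  have hs0 : 0 ≤ Real.sqrt 3 := Real.sqrt_nonneg _
  have n1 : ‖Complex.I * (z / 2)‖ ≤ 100 / 61 := by
    rw [norm_mul, Complex.norm_I, norm_div, one_mul]
    simp only [Complex.norm_ofNat]; linarith
  have n2 : ‖(Real.sqrt 3 : ℂ) * z / 2‖ ≤ Real.sqrt 3 * (100 / 61) := by
    rw [norm_div, norm_mul, h3]
    simp only [Complex.norm_ofNat]
    have := mul_le_mul_of_nonneg_left hz hs0
    linarith
  have key : ∀ (x : ℂ) (c : ℝ), ‖x‖ ≤ c → c ≤ 4 →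
      ‖Complex.exp x - ∑ m ∈ Finset.range 24, x ^ m / m.factorial‖ ≤
        c ^ 24 / (Nat.factorial 24 : ℕ) * 2 := by
    intro x c hx hc
    refine (Complex.exp_bound' ?_).trans ?_
    · rw [div_le_iff₀ (by positivity)]; norm_num; linarith
    · gcongr
  have a1 := key _ _ n1 (by norm_num)
  have a2 := key (-(Complex.I * (z / 2))) (100 / 61) (by rwa [norm_neg]) (by norm_num)
  have a3 := key _ _ n2 (by linarith)
  have a4 := key (-((Real.sqrt 3 : ℂ) * z / 2)) (Real.sqrt 3 * (100 / 61)) (by rwa [norm_neg]) (by linarith)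
  have e : (Real.sqrt 3 * (100 / 61)) ^ 24 = 3 ^ 12 * (100 / 61) ^ 24 := by
    rw [mul_pow]
    congr 1
    rw [show 24 = 2 * 12 from rfl, pow_mul, Real.sq_sqrt (by norm_num)]
  rw [e] at a3 a4
  have hsum : ∑ k ∈ Finset.range 24, (dk k : ℂ) * z ^ k =
    3 / 2 * (∑ k ∈ Finset.range 24, (Complex.I * (z / 2)) ^ k / k.factorial +
      ∑ k ∈ Finset.range 24, (-(Complex.I * (z / 2))) ^ k / k.factorial) -
    (Real.sqrt 3 : ℂ) / 2 * (∑ k ∈ Finset.range 24, ((Real.sqrt 3 : ℂ) * z / 2) ^ k / k.factorial -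
      ∑ k ∈ Finset.range 24, (-((Real.sqrt 3 : ℂ) * z / 2)) ^ k / k.factorial) := by
    simp only [dk_eq]
    rw [Finset.sum_sub_distrib, ← Finset.mul_sum, ← Finset.mul_sum, Finset.sum_add_distrib,
      Finset.sum_sub_distrib]
  rw [hsum, DD_exp]
  generalize Complex.exp (Complex.I * (z / 2)) = x1 at *
  generalize Complex.exp (-(Complex.I * (z / 2))) = x2 at *
  generalize Complex.exp ((Real.sqrt 3 : ℂ) * z / 2) = x3 at *
  generalize Complex.exp (-((Real.sqrt 3 : ℂ) * z / 2)) = x4 at *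
  generalize ∑ k ∈ Finset.range 24, (Complex.I * (z / 2)) ^ k / (k.factorial : ℂ) = y1 at *
  generalize ∑ k ∈ Finset.range 24, (-(Complex.I * (z / 2))) ^ k / (k.factorial : ℂ) = y2 at *
  generalize ∑ k ∈ Finset.range 24, ((Real.sqrt 3 : ℂ) * z / 2) ^ k / (k.factorial : ℂ) = y3 at *
  generalize ∑ k ∈ Finset.range 24, (-((Real.sqrt 3 : ℂ) * z / 2)) ^ k / (k.factorial : ℂ) = y4
    at *
  have : 3 / 2 * (x1 + x2) - (Real.sqrt 3 : ℂ) / 2 * (x3 - x4) -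
      (3 / 2 * (y1 + y2) - (Real.sqrt 3 : ℂ) / 2 * (y3 - y4)) =
      3 / 2 * ((x1 - y1) + (x2 - y2)) - (Real.sqrt 3 : ℂ) / 2 * ((x3 - y3) - (x4 - y4)) := by ring
  rw [this]
  have b1 := norm_sub_le (3 / 2 * ((x1 - y1) + (x2 - y2)))
    ((Real.sqrt 3 : ℂ) / 2 * ((x3 - y3) - (x4 - y4)))
  have b2 := norm_add_le (x1 - y1) (x2 - y2)
  have b3 := norm_sub_le (x3 - y3) (x4 - y4)
  rw [norm_mul, norm_mul, norm_div, norm_div, h3] at b1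
  simp only [Complex.norm_ofNat] at b1
  have b4 : Real.sqrt 3 / 2 * ‖(x3 - y3) - (x4 - y4)‖ ≤ 1 * ‖(x3 - y3) - (x4 - y4)‖ := by
    gcongr; linarith
  norm_num [Nat.factorial] at a1 a2 a3 a4
  norm_num
  linarith

theorem tau_close (k : ℕ) (hk : k < 24) :
    |dk k * (200 / 61) ^ k - (tauL.getD k 0 : ℝ) / 10 ^ 13| ≤ 1 / 10 ^ 13 := by
  rw [abs_le]
  interval_cases k <;> norm_num [dk, tauL, Nat.factorial]

theorem tau_small (w : ℂ) (hw : ‖w‖ ≤ 1) (h : DD (200 / 61 * w) = 0) : ‖leval tauL w‖ ≤ 40 := by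
  have h1 := DD_taylor (200 / 61 * w) (by
    rw [norm_mul]; norm_num; linarith)
  rw [h, zero_sub, norm_neg] at h1
  have h2 : ‖∑ k ∈ Finset.range 24, (dk k : ℂ) * (200 / 61 * w) ^ k - leval tauL w / 10 ^ 13‖ ≤
      24 * (1 / 10 ^ 13) := by
    rw [leval_sum, show tauL.length = 24 from rfl, Finset.sum_div, ← Finset.sum_sub_distrib]
    refine (norm_sum_le _ _).trans ?_
    calc _ ≤ ∑ k ∈ Finset.range 24, (1 / 10 ^ 13 : ℝ) := by
          refine Finset.sum_le_sum fun k hk => ?_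
          have h3 := tau_close k (Finset.mem_range.1 hk)
          have : (dk k : ℂ) * (200 / 61 * w) ^ k - (tauL.getD k 0 : ℂ) * w ^ k / 10 ^ 13 =
            ((dk k * (200 / 61) ^ k - (tauL.getD k 0 : ℝ) / 10 ^ 13 : ℝ) : ℂ) * w ^ k := by
            push_cast; ring
          rw [this, norm_mul, Complex.norm_real, norm_pow, Real.norm_eq_abs]
          calc _ ≤ 1 / 10 ^ 13 * (1 : ℝ) := by
                gcongr
                exact pow_le_one₀ (norm_nonneg _) hw
            _ = _ := by ring
      _ = _ := by simp
  have h3 : ‖leval tauL w / 10 ^ 13‖ ≤ 24 * (1 / 10 ^ 13) + 1 / 10 ^ 12 := by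
    have := norm_sub_norm_le (leval tauL w / 10 ^ 13)
      (∑ k ∈ Finset.range 24, (dk k : ℂ) * (200 / 61 * w) ^ k)
    rw [norm_sub_rev] at this
    linarith
  rw [norm_div] at h3
  have h4 : ‖(10 ^ 13 : ℂ)‖ = 10 ^ 13 := by simp
  rw [h4, div_le_iff₀ (by norm_num)] at h3
  norm_num at h3
  linarith

theorem lin_small (w : ℂ) (hw : ‖w‖ ≤ 1) (h : DD (200 / 61 * w) = 0) :
    ‖(10 ^ 11 : ℂ) - 252240121536 * w‖ ≤ 4 * 10 ^ 9 := by
  have h1 := tau_small w hw h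
  have h2 : ‖leval pL w‖ ≤ 7 * 10 ^ 11 :=
    (leval_norm pL w hw).trans (by exact_mod_cast cert2)
  have h3 := (leval_norm _ w hw).trans (Nat.cast_le (α := ℝ).2 cert1)
  rw [leval_ladd, leval_lscale, leval_lscale, leval_lmul, leval_lmul] at h3
  have h4 : ‖leval linL w * leval quadL w‖ ≤ 3 * 10 ^ 23 := by
    have e : leval linL w * leval quadL w = ((10 ^ 8 : ℤ) : ℂ) * (leval tauL w * leval pL w) -
      (((10 ^ 8 : ℤ) : ℂ) * (leval tauL w * leval pL w) +
        ((-1 : ℤ) : ℂ) * (leval linL w * leval quadL w)) := by push_cast; ring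
    rw [e]
    refine (norm_sub_le _ _).trans ?_
    have : ‖((10 ^ 8 : ℤ) : ℂ) * (leval tauL w * leval pL w)‖ ≤ 10 ^ 8 * (40 * (7 * 10 ^ 11)) := by
      rw [norm_mul, norm_mul]
      have h10 : ‖((10 ^ 8 : ℤ) : ℂ)‖ = 10 ^ 8 := by norm_num
      rw [h10]
      gcongr
    push_cast at h3 this ⊢
    norm_num at h3 this ⊢
    linarith
  have h5 : leval linL w = (10 ^ 11 : ℂ) - 252240121536 * w := by
    simp only [linL, leval]; push_cast; ring
  have fac : ∀ o : ℂ, ‖o‖ ≤ 9999 * 10 ^ 7 → (10 ^ 7 : ℝ) ≤ ‖(10 ^ 11 : ℂ) - o * w‖ := by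
    intro o ho
    have := norm_sub_norm_le (10 ^ 11 : ℂ) (o * w)
    have h10 : ‖(10 ^ 11 : ℂ)‖ = 10 ^ 11 := by simp
    rw [h10, norm_mul] at this
    have : ‖o‖ * ‖w‖ ≤ 9999 * 10 ^ 7 * 1 := by gcongr
    norm_num at *
    linarith
  have hn : ∀ s : ℝ, s ^ 2 = 77835867257 ^ 2 →
      ‖(-62763176570 : ℂ) + s * Complex.I‖ ≤ 9999 * 10 ^ 7 := by
    intro s hs
    have : (-62763176570 : ℂ) + s * Complex.I = ((-62763176570 : ℝ) : ℂ) + s * Complex.I := by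
      push_cast; ring
    rw [this, Complex.norm_add_mul_I, Real.sqrt_le_left (by norm_num), hs]
    norm_num
  have h6 : leval quadL w =
      ((10 ^ 11 : ℂ) - (-62763176570 + (77835867257 : ℝ) * Complex.I) * w) *
      ((10 ^ 11 : ℂ) - (-62763176570 + (-77835867257 : ℝ) * Complex.I) * w) := by
    simp only [quadL, leval]; push_cast
    linear_combination (77835867257 ^ 2 * w ^ 2) * Complex.I_sq
  have f1 := fac _ (hn 77835867257 (by norm_num))
  have f2 := fac _ (hn (-77835867257) (by norm_num))
  rw [h6, h5, norm_mul, norm_mul] at h4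
  generalize ‖(10 ^ 11 : ℂ) - 252240121536 * w‖ = A at *
  by_contra hA
  push Not at hA
  have : (4 * 10 ^ 9 : ℝ) * (10 ^ 7 * 10 ^ 7) ≤ 3 * 10 ^ 23 := by
    refine le_trans ?_ h4
    gcongr
  norm_num at this

theorem zero_disc (z : ℂ) (hz : ‖z‖ ≤ 200 / 61) (h : DD z = 0) :
    (0 < z.re ∧ z.re < 2) ∧ |z.im| < 1 := by
  obtain ⟨w, rfl⟩ : ∃ w, z = 200 / 61 * w := ⟨61 / 200 * z, by ring⟩
  have hw : ‖w‖ ≤ 1 := by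
    rw [norm_mul] at hz; norm_num at hz; linarith
  have h1 := lin_small w hw h
  have h2 := (Complex.abs_re_le_norm _).trans h1
  have h3 := (Complex.abs_im_le_norm _).trans h1
  have e1 : ((10 ^ 11 : ℂ) - 252240121536 * w) = ((10 ^ 11 : ℝ) : ℂ) - ((252240121536 : ℝ) : ℂ) * w := by
    push_cast; ring
  have e2 : (200 / 61 * w) = ((200 / 61 : ℝ) : ℂ) * w := by push_cast; ring
  rw [e1, Complex.sub_re, Complex.re_ofReal_mul, Complex.ofReal_re, abs_le] at h2
  rw [e1, Complex.sub_im, Complex.im_ofReal_mul, Complex.ofReal_im, abs_le] at h3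
  rw [e2, Complex.re_ofReal_mul, Complex.im_ofReal_mul, abs_lt]
  norm_num at *
  refine ⟨⟨?_, ?_⟩, ?_, ?_⟩ <;> linarith

/-! ### Part 4: the real zero and the analytic argument -/

noncomputable def Dr (x : ℝ) : ℝ :=
  3 * Real.cos (x / 2) - Real.sqrt 3 * Real.sinh (Real.sqrt 3 * x / 2)

theorem DD_ofReal (x : ℝ) : DD (x : ℂ) = (Dr x : ℂ) := by
  unfold DD Dr; push_cast; rfl

noncomputable def DD' (z : ℂ) : ℂ :=
  -(3 / 2) * (Complex.sin (z / 2) + Complex.cosh ((Real.sqrt 3 : ℂ) * z / 2))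

noncomputable def Dr' (x : ℝ) : ℝ :=
  -(3 / 2) * (Real.sin (x / 2) + Real.cosh (Real.sqrt 3 * x / 2))

theorem DD'_ofReal (x : ℝ) : DD' (x : ℂ) = (Dr' x : ℂ) := by
  unfold DD' Dr'; push_cast; rfl

theorem DD_hasDerivAt (z : ℂ) : HasDerivAt DD (DD' z) z := by
  unfold DD DD'
  have h1 : HasDerivAt (fun z : ℂ => z / 2) (1 / 2) z := (hasDerivAt_id z).div_const 2
  have h2 : HasDerivAt (fun z : ℂ => (Real.sqrt 3 : ℂ) * z / 2) ((Real.sqrt 3 : ℂ) * 1 / 2) z :=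
    ((hasDerivAt_id z).const_mul (Real.sqrt 3 : ℂ)).div_const 2
  have h := (h1.ccos.const_mul 3).sub (h2.csinh.const_mul (Real.sqrt 3 : ℂ))
  refine h.congr_deriv ?_
  linear_combination (-(1 / 2) * Complex.cosh ((Real.sqrt 3 : ℂ) * z / 2)) * sqrt3_sq

theorem Dr_hasDerivAt (x : ℝ) : HasDerivAt Dr (Dr' x) x := by
  have h := (DD_hasDerivAt (x : ℂ)).real_of_complex
  rw [DD'_ofReal] at h
  have e : (fun x : ℝ => (DD (x : ℂ)).re) = Dr := by
    funext y; rw [DD_ofReal, Complex.ofReal_re]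
  rw [e, Complex.ofReal_re] at h
  exact h

theorem Dr'_neg (x : ℝ) (h0 : 0 ≤ x) (h2 : x ≤ 2) : Dr' x < 0 := by
  unfold Dr'
  have h1 : 0 ≤ Real.sin (x / 2) :=
    Real.sin_nonneg_of_nonneg_of_le_pi (by linarith) (by linarith [Real.pi_gt_three])
  have h3 := Real.cosh_pos (Real.sqrt 3 * x / 2)
  linarith

theorem Dr_cont : Continuous Dr :=
  continuous_iff_continuousAt.2 fun x => (Dr_hasDerivAt x).continuousAt

theorem Dr_anti : StrictAntiOn Dr (Set.Icc 0 2) := by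
  refine strictAntiOn_of_deriv_neg (convex_Icc 0 2) Dr_cont.continuousOn ?_
  intro x hx
  rw [interior_Icc] at hx
  rw [(Dr_hasDerivAt x).deriv]
  exact Dr'_neg x hx.1.le hx.2.le

theorem Dr_zero : Dr 0 = 3 := by simp [Dr]

theorem Dr_two : Dr 2 < 0 := by
  unfold Dr
  have e : Real.sqrt 3 * 2 / 2 = Real.sqrt 3 := by ring
  rw [e, show (2 / 2 : ℝ) = 1 by norm_num]
  have h1 : Real.sqrt 3 ≤ Real.sinh (Real.sqrt 3) := Real.self_le_sinh_iff.2 (Real.sqrt_nonneg _)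
  have h2 : Real.cos 1 < 1 := by
    have := Real.cos_lt_one_div_sqrt_sq_add_one (x := 1) (by linarith [Real.pi_gt_three])
      (by linarith [Real.pi_gt_three]) (by norm_num)
    refine this.trans_le ?_
    rw [div_le_one (by positivity)]
    exact Real.one_le_sqrt.2 (by norm_num)
  have h3 := mul_le_mul_of_nonneg_left h1 (Real.sqrt_nonneg 3)
  rw [Real.mul_self_sqrt (by norm_num)] at h3
  linarith

theorem Dr_exists : ∃ α ∈ Set.Ioo (0 : ℝ) 2, Dr α = 0 := by
  have := intermediate_value_Ioo' (by norm_num : (0 : ℝ) ≤ 2) Dr_cont.continuousOn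
  have h0 : (0 : ℝ) ∈ Set.Ioo (Dr 2) (Dr 0) := ⟨Dr_two, by rw [Dr_zero]; norm_num⟩
  exact this h0

theorem Dr_unique {a b : ℝ} (ha : a ∈ Set.Ioo (0 : ℝ) 2) (hb : b ∈ Set.Ioo (0 : ℝ) 2)
    (h1 : Dr a = 0) (h2 : Dr b = 0) : a = b :=
  Dr_anti.injOn (Set.Ioo_subset_Icc_self ha) (Set.Ioo_subset_Icc_self hb) (h1.trans h2.symm)

theorem DD_im (x y : ℝ) : (DD (x + y * Complex.I)).im =
    -(3 * Real.sin (x / 2) * Real.sinh (y / 2) +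
      Real.sqrt 3 * Real.cosh (Real.sqrt 3 * x / 2) * Real.sin (Real.sqrt 3 * y / 2)) := by
  have e1 : ((x : ℂ) + y * Complex.I) / 2 = ((x / 2 : ℝ) : ℂ) + ((y / 2 : ℝ) : ℂ) * Complex.I := by
    push_cast; ring
  have e2 : (Real.sqrt 3 : ℂ) * ((x : ℂ) + y * Complex.I) / 2 =
      ((Real.sqrt 3 * x / 2 : ℝ) : ℂ) + ((Real.sqrt 3 * y / 2 : ℝ) : ℂ) * Complex.I := by
    push_cast; ring
  unfold DD
  rw [e1, e2, Complex.cos_add_mul_I, Complex.sinh_add, Complex.sinh_mul_I, Complex.cosh_mul_I]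
  rw [← Complex.ofReal_cos, ← Complex.ofReal_sin, ← Complex.ofReal_cos, ← Complex.ofReal_sin,
    ← Complex.ofReal_sinh, ← Complex.ofReal_sinh, ← Complex.ofReal_cosh, ← Complex.ofReal_cosh]
  generalize Real.cos (x / 2) = c1
  generalize Real.sin (x / 2) = c2
  generalize Real.cosh (y / 2) = c3
  generalize Real.sinh (y / 2) = c4
  generalize Real.cos (Real.sqrt 3 * y / 2) = c5
  generalize Real.sin (Real.sqrt 3 * y / 2) = c6
  generalize Real.cosh (Real.sqrt 3 * x / 2) = c7
  generalize Real.sinh (Real.sqrt 3 * x / 2) = c8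
  simp
  ring

theorem zero_real (z : ℂ) (h : DD z = 0) (h0 : 0 < z.re) (h2 : z.re < 2) (h1 : |z.im| < 1) :
    z.im = 0 := by
  have hi := DD_im z.re z.im
  rw [Complex.re_add_im, h, Complex.zero_im] at hi
  have hs : 0 < Real.sqrt 3 := by positivity
  have h32 : Real.sqrt 3 ≤ 2 := by
    rw [Real.sqrt_le_left (by norm_num)]; norm_num
  have hx : 0 < Real.sin (z.re / 2) :=
    Real.sin_pos_of_pos_of_lt_pi (by linarith) (by linarith [Real.pi_gt_three])
  have hc := Real.cosh_pos (Real.sqrt 3 * z.re / 2)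
  rw [abs_lt] at h1
  rcases lt_trichotomy z.im 0 with hy | hy | hy
  · have a1 : Real.sinh (z.im / 2) < 0 := Real.sinh_neg_iff.2 (by linarith)
    have a2 : Real.sin (Real.sqrt 3 * z.im / 2) < 0 :=
      Real.sin_neg_of_neg_of_neg_pi_lt (by nlinarith) (by nlinarith [Real.pi_gt_three])
    have b1 := mul_neg_of_pos_of_neg (mul_pos three_pos hx) a1
    have b2 := mul_neg_of_pos_of_neg (mul_pos hs hc) a2
    linarith
  · exact hy
  · have a1 : 0 < Real.sinh (z.im / 2) := Real.sinh_pos_iff.2 (by linarith)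
    have a2 : 0 < Real.sin (Real.sqrt 3 * z.im / 2) :=
      Real.sin_pos_of_pos_of_lt_pi (by positivity) (by nlinarith [Real.pi_gt_three])
    have b1 := mul_pos (mul_pos three_pos hx) a1
    have b2 := mul_pos (mul_pos hs hc) a2
    linarith

theorem DD_zero_unique {α : ℝ} (hα : α ∈ Set.Ioo (0 : ℝ) 2) (h0 : Dr α = 0) (z : ℂ)
    (hz : ‖z‖ ≤ 200 / 61) (h : DD z = 0) : z = α := by
  obtain ⟨⟨h1, h2⟩, h3⟩ := zero_disc z hz h
  have hi := zero_real z h h1 h2 h3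
  have e : z = (z.re : ℂ) := by
    apply Complex.ext <;> simp [hi]
  rw [e, DD_ofReal] at h
  rw [e, Dr_unique ⟨h1, h2⟩ hα (by exact_mod_cast h) h0]

theorem FF_DD (z : ℂ) (hz : ‖z‖ < 1)
    (hne : Complex.cosh ((Real.sqrt 3 : ℂ) * z / 2) - Complex.sin (z / 2) ≠ 0) :
    FF z * DD z = -2 * DD' z := by
  have hr := sqrt3_sq
  have hI := Complex.I_sq
  have H1 := FF_eq (((Real.sqrt 3 : ℂ) + Complex.I) / 2) (by
    linear_combination ((Real.sqrt 3 : ℂ) ^ 2 / 16 + (Real.sqrt 3 : ℂ) * Complex.I / 4 + 3 * Complex.I ^ 2 / 8 - 1 / 16) * hr +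
      ((Real.sqrt 3 : ℂ) * Complex.I / 4 + Complex.I ^ 2 / 16 + 13 / 16) * hI) z hz
  have H2 := FF_eq (((Real.sqrt 3 : ℂ) - Complex.I) / 2) (by
    linear_combination ((Real.sqrt 3 : ℂ) ^ 2 / 16 - (Real.sqrt 3 : ℂ) * Complex.I / 4 + 3 * Complex.I ^ 2 / 8 - 1 / 16) * hr +
      (-(Real.sqrt 3 : ℂ) * Complex.I / 4 + Complex.I ^ 2 / 16 + 13 / 16) * hI) z hz
  have e1 : ((Real.sqrt 3 : ℂ) + Complex.I) / 2 * z =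
    (Real.sqrt 3 : ℂ) * z / 2 + z / 2 * Complex.I := by ring
  have e2 : ((Real.sqrt 3 : ℂ) - Complex.I) / 2 * z =
    (Real.sqrt 3 : ℂ) * z / 2 - z / 2 * Complex.I := by ring
  have e3 : (((Real.sqrt 3 : ℂ) + Complex.I) / 2) ^ 3 = Complex.I := by
    linear_combination ((Real.sqrt 3 : ℂ) / 8 + 3 * Complex.I / 8) * hr +
      (3 * (Real.sqrt 3 : ℂ) / 8 + Complex.I / 8) * hI
  have e4 : (((Real.sqrt 3 : ℂ) - Complex.I) / 2) ^ 3 = -Complex.I := by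
    linear_combination ((Real.sqrt 3 : ℂ) / 8 - 3 * Complex.I / 8) * hr +
      (3 * (Real.sqrt 3 : ℂ) / 8 - Complex.I / 8) * hI
  have e5 : (((Real.sqrt 3 : ℂ) + Complex.I) / 2) ^ 2 =
      (1 + Complex.I * (Real.sqrt 3 : ℂ)) / 2 := by
    linear_combination (1 / 4) * hr + (1 / 4) * hI
  have e6 : (((Real.sqrt 3 : ℂ) - Complex.I) / 2) ^ 2 =
      (1 - Complex.I * (Real.sqrt 3 : ℂ)) / 2 := by
    linear_combination (1 / 4) * hr + (1 / 4) * hI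
  rw [e1, e3, e5, Complex.cosh_add, Complex.sinh_add, Complex.sinh_mul_I, Complex.cosh_mul_I] at H1
  rw [e2, e4, e6, Complex.cosh_sub, Complex.sinh_sub, Complex.sinh_mul_I, Complex.cosh_mul_I] at H2
  have hCh := Complex.cosh_sq_sub_sinh_sq ((Real.sqrt 3 : ℂ) * z / 2)
  have hsc := Complex.sin_sq_add_cos_sq (z / 2)
  unfold DD DD'
  generalize Complex.cosh ((Real.sqrt 3 : ℂ) * z / 2) = Ch at *
  generalize Complex.sinh ((Real.sqrt 3 : ℂ) * z / 2) = S at *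
  generalize Complex.cos (z / 2) = c at *
  generalize Complex.sin (z / 2) = s at *
  generalize (Real.sqrt 3 : ℂ) = r at *
  generalize FF z = F at *
  generalize CC z = C at *
  have hPY : (1 - Ch * s + Complex.I * S * c) * (Ch * c - Complex.I * S * s) =
      (Ch - s) * (c + Complex.I * S) := by
    linear_combination (-s * c) * hCh + (-s * c * S ^ 2) * hI + Complex.I * S * Ch * hsc
  have hQX : (1 - Ch * s - Complex.I * S * c) * (Ch * c + Complex.I * S * s) =
      (Ch - s) * (c - Complex.I * S) := by
    linear_combination (-s * c) * hCh + (-s * c * S ^ 2) * hI - Complex.I * S * Ch * hsc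
  have hXY : (Ch * c + Complex.I * S * s) * (Ch * c - Complex.I * S * s) =
      (Ch - s) * (Ch + s) := by
    linear_combination (-s ^ 2) * hCh + (-s ^ 2 * S ^ 2) * hI + Ch ^ 2 * hsc
  have K1 : F * (1 - Ch * s + Complex.I * S * c) =
      (Ch * c + Complex.I * S * s) * (1 + (1 + Complex.I * r) / 2 * C) := by
    linear_combination H1 - F * Ch * s * hI
  have K2 : F * (1 - Ch * s - Complex.I * S * c) =
      (Ch * c - Complex.I * S * s) * (1 + (1 - Complex.I * r) / 2 * C) := by
    linear_combination H2 - F * Ch * s * hI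
  have K3 : (Ch - s) * (F * (-Complex.I * r * c + Complex.I * S) + Complex.I * r * (Ch + s)) = 0 := by
    linear_combination (1 - Complex.I * r) / 2 * (Ch * c - Complex.I * S * s) * K1 -
      (1 + Complex.I * r) / 2 * (Ch * c + Complex.I * S * s) * K2 -
      F * (1 - Complex.I * r) / 2 * hPY + F * (1 + Complex.I * r) / 2 * hQX -
      Complex.I * r * hXY
  have K4 := (mul_eq_zero.1 K3).resolve_left hne
  linear_combination Complex.I * r * K4 + (r ^ 2 * c * F - r * S * F - r ^ 2 * (Ch + s)) * hI +
    (-c * F + (Ch + s)) * hr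

theorem coef_bound {G : ℂ → ℂ} {a : ℕ → ℂ} {R : NNReal} (hR : 0 < R)
    (hG : DifferentiableOn ℂ G (Metric.closedBall 0 R))
    (ha : ∀ᶠ z in nhds (0 : ℂ), HasSum (fun n => a n * z ^ n) (G z)) :
    ∃ C : ℝ, 0 < C ∧ ∀ n, ‖a n‖ ≤ C * ((R : ℝ)⁻¹) ^ n := by
  have h1 := (hG.hasFPowerSeriesOnBall hR).hasFPowerSeriesAt
  have h2 : HasFPowerSeriesAt G (FormalMultilinearSeries.ofScalars ℂ a) 0 := by
    rw [hasFPowerSeriesAt_iff]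
    filter_upwards [ha] with z hz
    simp only [FormalMultilinearSeries.coeff_ofScalars, smul_eq_mul, zero_add]
    simpa only [mul_comm] using hz
  have h3 := h2.eq_formalMultilinearSeries h1
  set M : ℝ := (2 * Real.pi)⁻¹ * ∫ (θ : ℝ) in (0)..2 * Real.pi, ‖G (circleMap 0 R θ)‖ with hM
  refine ⟨|M| + 1, by positivity, fun n => ?_⟩
  have h4 := norm_cauchyPowerSeries_le G 0 R n
  rw [← h3, FormalMultilinearSeries.norm_apply_eq_norm_coef,
    FormalMultilinearSeries.coeff_ofScalars, ← hM, abs_of_nonneg R.coe_nonneg] at h4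
  refine h4.trans ?_
  have : M ≤ |M| + 1 := by linarith [le_abs_self M]
  have h0 : (0 : ℝ) ≤ (R : ℝ)⁻¹ := inv_nonneg.2 R.coe_nonneg
  gcongr

theorem DD_diff : Differentiable ℂ DD := fun z => (DD_hasDerivAt z).differentiableAt

theorem DD'_diff : Differentiable ℂ DD' := by
  unfold DD'
  fun_prop

theorem dslope_diff {f : ℂ → ℂ} (hf : Differentiable ℂ f) (a : ℂ) :
    Differentiable ℂ (dslope f a) := by
  rw [← differentiableOn_univ] at hf ⊢
  exact (Complex.differentiableOn_dslope Filter.univ_mem).2 hf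

theorem main_bound {α : ℝ} (hα : α ∈ Set.Ioo (0 : ℝ) 2) (h0 : Dr α = 0) :
    ∃ C : ℝ, 0 < C ∧ ∀ n : ℕ,
      |(fCount n : ℝ) / n.factorial - 2 / α ^ (n + 1)| ≤ C * (0.305 : ℝ) ^ n := by
  have hDα : DD α = 0 := by rw [DD_ofReal, h0, Complex.ofReal_zero]
  set num : ℂ → ℂ := fun z => -2 * DD' z + 2 * dslope DD α z with hnum
  have hnumd : Differentiable ℂ num :=
    (DD'_diff.const_mul _).add ((dslope_diff DD_diff _).const_mul _)
  have hnumα : num α = 0 := by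
    rw [hnum]
    simp only [dslope_same, (DD_hasDerivAt (α : ℂ)).deriv]
    ring
  set G : ℂ → ℂ := fun z => dslope num α z / dslope DD α z with hGdef
  have hs : ∀ (f : ℂ → ℂ), f α = 0 → ∀ z : ℂ, z ≠ α → dslope f α z = f z / (z - α) := by
    intro f hf z hz
    rw [dslope_of_ne _ hz, slope_def_field, hf, sub_zero]
  have hne : ∀ z ∈ Metric.closedBall (0 : ℂ) (200 / 61 : NNReal), dslope DD α z ≠ 0 := by
    intro z hz
    rw [mem_closedBall_zero_iff] at hz
    push_cast at hz
    by_cases hzα : z = α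
    · rw [hzα, dslope_same, (DD_hasDerivAt (α : ℂ)).deriv, DD'_ofReal]
      exact_mod_cast (Dr'_neg α hα.1.le hα.2.le).ne
    · rw [hs DD hDα z hzα]
      exact div_ne_zero (fun h => hzα (DD_zero_unique hα h0 z hz h)) (sub_ne_zero.2 hzα)
  have hG : DifferentiableOn ℂ G (Metric.closedBall 0 (200 / 61 : NNReal)) :=
    ((dslope_diff hnumd _).differentiableOn).div ((dslope_diff DD_diff _).differentiableOn) hne
  have hser : ∀ᶠ z in nhds (0 : ℂ), HasSum
      (fun n : ℕ => (ff n / n.factorial - 2 / (α : ℂ) ^ (n + 1)) * z ^ n) (G z) := by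
    have c1 : ∀ᶠ z in nhds (0 : ℂ), ‖z‖ < min 1 α := by
      have := Metric.ball_mem_nhds (0 : ℂ) (lt_min one_pos hα.1)
      filter_upwards [this] with z hz
      simpa using hz
    have c2 : ∀ᶠ z in nhds (0 : ℂ),
        Complex.cosh ((Real.sqrt 3 : ℂ) * z / 2) - Complex.sin (z / 2) ≠ 0 := by
      have hc : Continuous fun z : ℂ =>
        Complex.cosh ((Real.sqrt 3 : ℂ) * z / 2) - Complex.sin (z / 2) := by fun_prop
      exact hc.continuousAt.eventually_ne (by simp)
    filter_upwards [c1, c2] with z hz1 hz2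
    have hz3 : ‖z‖ < 1 := hz1.trans_le (min_le_left _ _)
    have hz4 : ‖z‖ < α := hz1.trans_le (min_le_right _ _)
    have hzα : z ≠ α := by
      rintro rfl
      rw [Complex.norm_real, Real.norm_of_nonneg hα.1.le] at hz4
      exact lt_irrefl _ hz4
    have hα0 : (α : ℂ) ≠ 0 := by exact_mod_cast hα.1.ne'
    have hFD := FF_DD z hz3 hz2
    have hzs := sub_ne_zero.2 hzα
    have hDz : DD z ≠ 0 := fun h => hzα (DD_zero_unique hα h0 z (by linarith) h)
    have hGz : G z = FF z - 2 / (α - z) := by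
      rw [hGdef]
      simp only
      rw [hs num hnumα z hzα, hs DD hDα z hzα, hnum]
      simp only
      rw [hs DD hDα z hzα, ← hFD]
      have : (α : ℂ) - z ≠ 0 := sub_ne_zero.2 hzα.symm
      rw [← neg_sub z (α : ℂ)]
      field_simp
      ring
    rw [hGz]
    have g1 := FF_hasSum z hz3
    have g2 : HasSum (fun n : ℕ => 2 / (α : ℂ) ^ (n + 1) * z ^ n) (2 / (α - z)) := by
      have : ‖z / α‖ < 1 := by
        rw [norm_div, Complex.norm_real, Real.norm_of_nonneg hα.1.le, div_lt_one hα.1]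
        exact hz4
      have g := (hasSum_geometric_of_norm_lt_one this).mul_left (2 / (α : ℂ))
      have e : 2 / (α : ℂ) * (1 - z / α)⁻¹ = 2 / (α - z) := by
        have : (α : ℂ) - z ≠ 0 := sub_ne_zero.2 hzα.symm
        have e1 : 1 - z / α = (α - z) / α := by field_simp
        rw [e1]
        field_simp
      rw [e] at g
      refine (hasSum_congr_aux fun n => ?_).1 g
      rw [div_pow]
      field_simp
      ring
    refine (hasSum_congr_aux fun n => ?_).1 (g1.sub g2)
    ring
  obtain ⟨C, hC, hb⟩ := coef_bound (R := 200 / 61) (by norm_num) hG hser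
  refine ⟨C, hC, fun n => ?_⟩
  have h := hb n
  have e : (ff n / n.factorial - 2 / (α : ℂ) ^ (n + 1)) =
      (((fCount n : ℝ) / n.factorial - 2 / α ^ (n + 1) : ℝ) : ℂ) := by
    rw [fCount_eq, ff]; push_cast; rfl
  rw [e, Complex.norm_real, Real.norm_eq_abs] at h
  have e2 : (((200 / 61 : NNReal) : ℝ))⁻¹ = 0.305 := by push_cast; norm_num
  rwa [e2] at h

theorem main_limit {α : ℝ} (hα : α ∈ Set.Ioo (0 : ℝ) 2) {C : ℝ} (a : ℕ → ℝ)
    (h : ∀ n : ℕ, |a n - 2 / α ^ (n + 1)| ≤ C * (0.305 : ℝ) ^ n) :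
    Filter.Tendsto (fun n : ℕ => α ^ (n + 1) * a n) Filter.atTop (nhds 2) := by
  have ha := hα.1
  have ha2 := hα.2
  rw [tendsto_iff_norm_sub_tendsto_zero]
  have ht : Filter.Tendsto (fun n : ℕ => (α * C) * (0.305 * α) ^ n) Filter.atTop (nhds 0) := by
    have := (tendsto_pow_atTop_nhds_zero_of_lt_one (r := 0.305 * α) (by positivity)
      (by linarith)).const_mul (α * C)
    simpa using this
  refine squeeze_zero (fun n => norm_nonneg _) (fun n => ?_) ht
  have hp : 0 < α ^ (n + 1) := by positivity
  have e : α ^ (n + 1) * a n - 2 = α ^ (n + 1) * (a n - 2 / α ^ (n + 1)) := by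
    field_simp
  rw [e, Real.norm_eq_abs, abs_mul, abs_of_pos hp]
  calc _ ≤ α ^ (n + 1) * (C * (0.305 : ℝ) ^ n) := by gcongr; exact h n
    _ = _ := by rw [mul_pow]; ring

/-- Let `D(z) = 3·cos(z/2) − √3·sinh(√3·z/2)`. Then there is a unique
`α ∈ (0, 2)` with `D(α) = 0`; and for this `α` there is a constant `C > 0` with
`|f(n)/n! − 2/α^(n+1)| ≤ C·(0.305)ⁿ` for all `n`; in particular
`α^(n+1)·f(n)/n! → 2` as `n → ∞`. -/
theorem statement6 :
    (∃! α : ℝ, α ∈ Set.Ioo (0 : ℝ) 2 ∧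
      3 * Real.cos (α / 2) - Real.sqrt 3 * Real.sinh (Real.sqrt 3 * α / 2) = 0) ∧
    (∀ α : ℝ, α ∈ Set.Ioo (0 : ℝ) 2 →
      3 * Real.cos (α / 2) - Real.sqrt 3 * Real.sinh (Real.sqrt 3 * α / 2) = 0 →
      ((∃ C : ℝ, 0 < C ∧ ∀ n : ℕ,
          |(fCount n : ℝ) / n.factorial - 2 / α ^ (n + 1)| ≤ C * (0.305 : ℝ) ^ n) ∧
        Filter.Tendsto (fun n : ℕ => α ^ (n + 1) * (fCount n : ℝ) / n.factorial)
          Filter.atTop (nhds 2))) := by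
  refine ⟨?_, fun α hα h0 => ?_⟩
  · obtain ⟨α, hα, h0⟩ := Dr_exists
    exact ⟨α, ⟨hα, h0⟩, fun β hβ => Dr_unique hβ.1 hα hβ.2 h0⟩
  · obtain ⟨C, hC, hb⟩ := main_bound hα h0
    refine ⟨⟨C, hC, hb⟩, ?_⟩
    simpa only [mul_div_assoc] using main_limit hα (fun n => (fCount n : ℝ) / n.factorial) hb
end

section
/- In the ring ℚ⟦X⟧ of formal power series over ℚ, let A be the power series whose coefficient of Xⁿ is Eₙ/n! if n ≡ 0 (mod 3), −Eₙ/n! if n ≡ 1 (mod 3), and 0 if n ≡ 2 (mod 3). Then A · (Σ_{n=0}^∞ f(n)·Xⁿ/n!) = 1. -/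
open Classical in
theorem tele (w : ℕ → Prop) (F N : ℕ → Prop)
    (hF : ∀ k, F k ↔ ∀ i, i < k → w i)
    (hN : ∀ k, N k ↔ ∀ i, k ≤ i → ¬ (w i ∧ w (i + 1))) (h0 : w 0) (J : ℕ) :
    ∑ k ∈ Finset.range (3 * J), (if k % 3 = 0 then (1 : ℚ) else if k % 3 = 1 then -1 else 0) *
      (if F k ∧ N (k + 1) then 1 else 0) =
      - (if F (3 * J) ∧ N (3 * J + 1) ∧ ¬ w (3 * J) then 1 else 0) := by
  have hFs : ∀ k, F (k + 1) ↔ F k ∧ w k := by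
    intro k
    rw [hF, hF]
    constructor
    · intro h
      exact ⟨fun i hi => h i (by omega), h k (by omega)⟩
    · rintro ⟨h, h'⟩ i hi
      rcases Nat.lt_succ_iff_lt_or_eq.1 hi with h1 | h1
      · exact h i h1
      · exact h1 ▸ h'
  have hNs : ∀ k, N k ↔ N (k + 1) ∧ ¬ (w k ∧ w (k + 1)) := by
    intro k
    rw [hN, hN]
    constructor
    · intro h
      exact ⟨fun i hi => h i (by omega), h k le_rfl⟩
    · rintro ⟨h, h'⟩ i hi
      rcases Nat.eq_or_lt_of_le hi with h1 | h1
      · exact h1 ▸ h'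
      · exact h i h1
  induction J with
  | zero => simp [h0]
  | succ J ih =>
    have e : 3 * (J + 1) = 3 * J + 1 + 1 + 1 := by ring
    rw [e, Finset.sum_range_succ, Finset.sum_range_succ, Finset.sum_range_succ, ih]
    have e0 : (3 * J) % 3 = 0 := by omega
    have e1 : (3 * J + 1) % 3 = 1 := by omega
    have e2 : (3 * J + 1 + 1) % 3 = 2 := by omega
    rw [e0, e1, e2]
    generalize 3 * J = k
    have a1 := hFs k
    have a2 := hFs (k + 1)
    have a3 := hFs (k + 1 + 1)
    have b1 := hNs (k + 1)
    have b2 := hNs (k + 1 + 1)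
    have b3 := hNs (k + 1 + 1 + 1)
    rw [a3, a2, a1, b1, b2, b3]
    by_cases c1 : F k <;> by_cases c2 : w k <;> by_cases c3 : w (k + 1) <;>
      by_cases c4 : w (k + 1 + 1) <;> by_cases c5 : w (k + 1 + 1 + 1) <;>
      by_cases c6 : N (k + 1 + 1 + 1 + 1) <;> by_cases c7 : w (k + 1 + 1 + 1 + 1) <;>
      simp [c1, c2, c3, c4, c5, c6, c7]

/-- alternating ascent of the sequence `x` at 0-based index `i`, with parity shift `b`. -/
def AA (b : ℕ) (x : ℕ → ℕ) (i : ℕ) : Prop :=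
  if (i + b) % 2 = 0 then x i < x (i + 1) else x (i + 1) < x i

def AllA (b m : ℕ) (x : ℕ → ℕ) : Prop := ∀ i, i + 1 < m → AA b x i

def NoAA (b m : ℕ) (x : ℕ → ℕ) : Prop := ∀ i, i + 2 < m → ¬ (AA b x i ∧ AA b x (i + 1))

def extF {m : ℕ} (y : Fin m → ℕ) (i : ℕ) : ℕ := if h : i < m then y ⟨i, h⟩ else 0

def PermSeq {m : ℕ} (σ : Equiv.Perm (Fin m)) : ℕ → ℕ := extF (fun i => (σ i : ℕ))

def Pat (m : ℕ) (Q : (ℕ → ℕ) → Prop) : Prop :=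
  ∀ x x' : ℕ → ℕ, (∀ i j, i < m → j < m → (x i < x j ↔ x' i < x' j)) → (Q x ↔ Q x')

theorem AA_congr {b m : ℕ} {x x' : ℕ → ℕ}
    (h : ∀ i j, i < m → j < m → (x i < x j ↔ x' i < x' j)) (i : ℕ) (hi : i + 1 < m) :
    AA b x i ↔ AA b x' i := by
  unfold AA
  rw [h i (i + 1) (by omega) hi, h (i + 1) i hi (by omega)]

theorem pat_AllA (b m : ℕ) : Pat m (AllA b m) := by
  intro x x' h
  unfold AllA
  exact forall_congr' fun i => forall_congr' fun hi => AA_congr h i hi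

theorem pat_NoAA (b m : ℕ) : Pat m (NoAA b m) := by
  intro x x' h
  unfold NoAA
  refine forall_congr' fun i => forall_congr' fun hi => ?_
  rw [AA_congr h i (by omega), AA_congr h (i + 1) (by omega)]

theorem count_pat {m : ℕ} (Q : (ℕ → ℕ) → Prop) (hQ : Pat m Q) (y : Fin m → ℕ)
    (hy : Function.Injective y) :
    Nat.card {α : Equiv.Perm (Fin m) // Q (extF (fun i => y (α i)))} =
      Nat.card {α : Equiv.Perm (Fin m) // Q (PermSeq α)} := by
  have hmono : StrictMono (y ∘ Tuple.sort y) :=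
    (Tuple.monotone_sort y).strictMono_of_injective (hy.comp (Tuple.sort y).injective)
  refine Nat.card_congr ((Equiv.mulLeft (Tuple.sort y)⁻¹).subtypeEquiv ?_)
  intro α
  apply hQ
  intro i j hi hj
  have key : ∀ a, y a = (y ∘ Tuple.sort y) ((Tuple.sort y)⁻¹ a) := by
    intro a; simp
  simp only [PermSeq, extF, hi, hj, dif_pos, Equiv.coe_mulLeft, Equiv.Perm.mul_apply]
  rw [key (α ⟨i, hi⟩), key (α ⟨j, hj⟩), hmono.lt_iff_lt]
  exact Fin.lt_def

theorem AA_rev {b m : ℕ} (σ : Equiv.Perm (Fin m)) (i : ℕ) (hi : i + 1 < m) :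
    AA (b + 1) (PermSeq (σ.trans Fin.revPerm)) i ↔ AA b (PermSeq σ) i := by
  have h1 : i < m := by omega
  have l1 := (σ ⟨i, h1⟩).isLt
  have l2 := (σ ⟨i + 1, hi⟩).isLt
  simp only [AA, PermSeq, extF, h1, hi, dif_pos, Equiv.trans_apply, Fin.revPerm_apply,
    Fin.val_rev]
  split_ifs <;> omega

theorem AA_two {b : ℕ} (x : ℕ → ℕ) (i : ℕ) : AA (b + 2) x i ↔ AA b x i := by
  unfold AA
  rw [show (i + (b + 2)) % 2 = (i + b) % 2 by omega]

theorem card_AllA (b m : ℕ) :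
    Nat.card {α : Equiv.Perm (Fin m) // AllA b m (PermSeq α)} =
    Nat.card {α : Equiv.Perm (Fin m) // AllA (b + 1) m (PermSeq α)} := by
  refine Nat.card_congr
    ((Equiv.mulLeft (Fin.revPerm : Equiv.Perm (Fin m))).subtypeEquiv ?_)
  intro α
  refine forall_congr' fun i => forall_congr' fun hi => ?_
  exact (AA_rev α i hi).symm

theorem card_NoAA (b m : ℕ) :
    Nat.card {α : Equiv.Perm (Fin m) // NoAA b m (PermSeq α)} =
    Nat.card {α : Equiv.Perm (Fin m) // NoAA (b + 1) m (PermSeq α)} := by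
  refine Nat.card_congr
    ((Equiv.mulLeft (Fin.revPerm : Equiv.Perm (Fin m))).subtypeEquiv ?_)
  intro α
  refine forall_congr' fun i => forall_congr' fun hi => ?_
  have h1 := AA_rev (b := b) α i (by omega)
  have h2 := AA_rev (b := b) α (i + 1) (by omega)
  exact not_congr (and_congr h1.symm h2.symm)

theorem permEnt_succ {n : ℕ} (σ : Equiv.Perm (Fin n)) (i : ℕ) (h : i < n) :
    permEnt σ (i + 1) = PermSeq σ i + 1 := by
  simp only [permEnt, PermSeq, extF, h, dif_pos, Nat.add_sub_cancel]
  rw [dif_pos ⟨by omega, by omega⟩]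

theorem euler_eq (n : ℕ) :
    eulerNum n = Nat.card {α : Equiv.Perm (Fin n) // AllA 0 n (PermSeq α)} := by
  rw [card_AllA]
  refine Nat.card_congr (Equiv.subtypeEquivRight ?_)
  intro σ
  constructor
  · intro h i hi
    have := h (i + 1) (by omega) hi
    rw [permEnt_succ σ i (by omega), permEnt_succ σ (i + 1) hi] at this
    unfold AA
    split_ifs with hp
    · have := this.2 (by omega); omega
    · have := this.1 (by omega); omega
  · intro h i h1 hi
    obtain ⟨j, rfl⟩ : ∃ j, i = j + 1 := ⟨i - 1, by omega⟩
    rw [permEnt_succ σ j (by omega), permEnt_succ σ (j + 1) hi]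
    have := h j hi
    unfold AA at this
    split_ifs at this with hp
    · constructor <;> intro <;> omega
    · constructor <;> intro <;> omega

theorem f_eq (n : ℕ) :
    fCount n = Nat.card {α : Equiv.Perm (Fin n) // NoAA 0 n (PermSeq α)} := by
  refine Nat.card_congr (Equiv.subtypeEquivRight ?_)
  intro σ
  constructor
  · rintro ⟨hv, hp⟩ i hi ⟨ha, hb⟩
    have e0 := permEnt_succ σ i (by omega)
    have e1 := permEnt_succ σ (i + 1) (by omega)
    have e2 := permEnt_succ σ (i + 1 + 1) (by omega)
    have hv' := hv (i + 1 + 1)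
    have hp' := hp (i + 1 + 1)
    unfold IsValley at hv'
    unfold IsPeak at hp'
    simp only [Nat.add_sub_cancel, e0, e1, e2] at hv' hp'
    unfold AA at ha hb
    by_cases hpar : i % 2 = 0
    · rw [if_pos (by omega)] at ha
      rw [if_neg (by omega)] at hb
      have := hp' ⟨by omega, by omega, by omega, by omega⟩
      omega
    · rw [if_neg (by omega)] at ha
      rw [if_pos (by omega)] at hb
      have := hv' ⟨by omega, by omega, by omega, by omega⟩
      omega
  · intro h
    constructor
    · rintro i ⟨h1, h2, h3, h4⟩
      obtain ⟨j, rfl⟩ : ∃ j, i = j + 1 + 1 := ⟨i - 2, by omega⟩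
      have e0 := permEnt_succ σ j (by omega)
      have e1 := permEnt_succ σ (j + 1) (by omega)
      have e2 := permEnt_succ σ (j + 1 + 1) (by omega)
      simp only [Nat.add_sub_cancel, e0, e1, e2] at h3 h4
      by_contra hpar
      apply h j (by omega)
      unfold AA
      rw [if_neg (by omega), if_pos (by omega)]
      omega
    · rintro i ⟨h1, h2, h3, h4⟩
      obtain ⟨j, rfl⟩ : ∃ j, i = j + 1 + 1 := ⟨i - 2, by omega⟩
      have e0 := permEnt_succ σ j (by omega)
      have e1 := permEnt_succ σ (j + 1) (by omega)
      have e2 := permEnt_succ σ (j + 1 + 1) (by omega)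
      simp only [Nat.add_sub_cancel, e0, e1, e2] at h3 h4
      by_contra hpar
      apply h j (by omega)
      unfold AA
      rw [if_pos (by omega), if_neg (by omega)]
      omega

theorem f_eq' (b n : ℕ) :
    fCount n = Nat.card {α : Equiv.Perm (Fin n) // NoAA b n (PermSeq α)} := by
  induction b with
  | zero => exact f_eq n
  | succ b ih => rw [ih, card_NoAA]

/-- block permutation -/
def blockP {k m : ℕ} (α : Equiv.Perm (Fin k)) (β : Equiv.Perm (Fin m)) :
    Equiv.Perm (Fin (k + m)) :=
  finSumFinEquiv.permCongr (Equiv.Perm.sumCongr α β)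

open Classical in
theorem block_count (k m : ℕ) (Q₁ Q₂ : (ℕ → ℕ) → Prop) (h₁ : Pat k Q₁) (h₂ : Pat m Q₂) :
    Nat.card {σ : Equiv.Perm (Fin (k + m)) //
        Q₁ (PermSeq σ) ∧ Q₂ (fun i => PermSeq σ (k + i))} * (k.factorial * m.factorial) =
      (k + m).factorial * (Nat.card {α : Equiv.Perm (Fin k) // Q₁ (PermSeq α)} *
        Nat.card {β : Equiv.Perm (Fin m) // Q₂ (PermSeq β)}) := by
  set R : Equiv.Perm (Fin (k + m)) → Prop :=
    fun σ => Q₁ (PermSeq σ) ∧ Q₂ (fun i => PermSeq σ (k + i)) with hR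
  have e1 : Nat.card {p : Equiv.Perm (Fin (k + m)) ×
      (Equiv.Perm (Fin k) × Equiv.Perm (Fin m)) // R (p.1 * blockP p.2.1 p.2.2)} =
      Nat.card {σ // R σ} * (k.factorial * m.factorial) := by
    have : k.factorial * m.factorial =
        Nat.card (Equiv.Perm (Fin k) × Equiv.Perm (Fin m)) := by
      simp [Fintype.card_perm]
    rw [this, ← Nat.card_prod]
    refine Nat.card_congr
      { toFun := fun p => (⟨p.1.1 * blockP p.1.2.1 p.1.2.2, p.2⟩, p.1.2)
        invFun := fun q => ⟨(q.1.1 * (blockP q.2.1 q.2.2)⁻¹, q.2), by simpa using q.1.2⟩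
        left_inv := ?_
        right_inv := ?_ }
    · rintro ⟨⟨s, a, b⟩, h⟩; simp
    · rintro ⟨⟨s, h⟩, a, b⟩; simp
  have e2 : Nat.card {p : Equiv.Perm (Fin (k + m)) ×
      (Equiv.Perm (Fin k) × Equiv.Perm (Fin m)) // R (p.1 * blockP p.2.1 p.2.2)} =
      ∑ σ : Equiv.Perm (Fin (k + m)), Nat.card
        {q : Equiv.Perm (Fin k) × Equiv.Perm (Fin m) // R (σ * blockP q.1 q.2)} := by
    rw [← Nat.card_sigma]
    exact Nat.card_congr
      { toFun := fun p => ⟨p.1.1, p.1.2, p.2⟩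
        invFun := fun q => ⟨(q.1, q.2.1), q.2.2⟩
        left_inv := fun _ => rfl
        right_inv := fun _ => rfl }
  have e3 : ∀ σ : Equiv.Perm (Fin (k + m)), Nat.card
        {q : Equiv.Perm (Fin k) × Equiv.Perm (Fin m) // R (σ * blockP q.1 q.2)} =
      Nat.card {α : Equiv.Perm (Fin k) // Q₁ (PermSeq α)} *
        Nat.card {β : Equiv.Perm (Fin m) // Q₂ (PermSeq β)} := by
    intro σ
    rw [← count_pat Q₁ h₁ (fun i => (σ (Fin.castAdd m i) : ℕ))
        (fun a b h => Fin.castAdd_injective k m (σ.injective (Fin.ext h))),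
      ← count_pat Q₂ h₂ (fun i => (σ (Fin.natAdd k i) : ℕ))
        (fun a b h => Fin.natAdd_injective m k (σ.injective (Fin.ext h))), ← Nat.card_prod]
    refine Nat.card_congr ((Equiv.subtypeEquivRight ?_).trans Equiv.subtypeProdEquivProd)
    rintro ⟨α, β⟩
    refine and_congr (h₁ _ _ ?_) (h₂ _ _ ?_)
    · intro i j hi hj
      have key : ∀ i, i < k → PermSeq (σ * blockP α β) i =
          extF (fun i => (σ (Fin.castAdd m (α i)) : ℕ)) i := by
        intro i hi
        have h1 : i < k + m := by omega
        have h2 : (⟨i, h1⟩ : Fin (k + m)) = Fin.castAdd m ⟨i, hi⟩ := rfl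
        simp only [PermSeq, extF, h1, hi, dif_pos, h2]
        rw [Equiv.Perm.mul_apply, blockP, Equiv.permCongr_apply, finSumFinEquiv_symm_apply_castAdd]
        simp
      rw [key i hi, key j hj]
    · intro i j hi hj
      have key : ∀ i, i < m → PermSeq (σ * blockP α β) (k + i) =
          extF (fun i => (σ (Fin.natAdd k (β i)) : ℕ)) i := by
        intro i hi
        have h1 : k + i < k + m := by omega
        have h2 : (⟨k + i, h1⟩ : Fin (k + m)) = Fin.natAdd k ⟨i, hi⟩ := rfl
        simp only [PermSeq, extF, h1, hi, dif_pos, h2]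
        rw [Equiv.Perm.mul_apply, blockP, Equiv.permCongr_apply, finSumFinEquiv_symm_apply_natAdd]
        simp
      rw [key i hi, key j hj]
  rw [← e1, e2, Finset.sum_congr rfl (fun σ _ => e3 σ)]
  simp [Fintype.card_perm]

/-- the first `k` entries alternate, the remaining ones have no two consecutive
alternating ascents -/
def PP (n k : ℕ) (x : ℕ → ℕ) : Prop := AllA 0 k x ∧ NoAA k (n - k) (fun i => x (k + i))

theorem PP_card (k m : ℕ) :
    (Nat.card {σ : Equiv.Perm (Fin (k + m)) // PP (k + m) k (PermSeq σ)} : ℚ) /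
      (k + m).factorial =
    (eulerNum k : ℚ) / k.factorial * ((fCount m : ℚ) / m.factorial) := by
  have h := block_count k m (AllA 0 k) (NoAA k m) (pat_AllA 0 k) (pat_NoAA k m)
  rw [← euler_eq, ← f_eq'] at h
  have h' : Nat.card {σ : Equiv.Perm (Fin (k + m)) // PP (k + m) k (PermSeq σ)} *
      (k.factorial * m.factorial) = (k + m).factorial * (eulerNum k * fCount m) := by
    rw [← h]
    unfold PP
    rw [Nat.add_sub_cancel_left]
  have h'' : (Nat.card {σ : Equiv.Perm (Fin (k + m)) // PP (k + m) k (PermSeq σ)} : ℚ) *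
      (k.factorial * m.factorial) = (k + m).factorial * (eulerNum k * fCount m) := by
    exact_mod_cast h'
  have f1 : (k.factorial : ℚ) ≠ 0 := by exact_mod_cast k.factorial_ne_zero
  have f2 : (m.factorial : ℚ) ≠ 0 := by exact_mod_cast m.factorial_ne_zero
  have f3 : ((k + m).factorial : ℚ) ≠ 0 := by exact_mod_cast (k + m).factorial_ne_zero
  rw [div_mul_div_comm, div_eq_div_iff f3 (mul_ne_zero f1 f2), h'']
  ring

open Classical in
theorem PP_sum (n : ℕ) (hn : 1 ≤ n) (x : ℕ → ℕ) :
    ∑ k ∈ Finset.range (n + 1), (if k % 3 = 0 then (1 : ℚ) else if k % 3 = 1 then -1 else 0) *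
      (if PP n k x then 1 else 0) = 0 := by
  set w : ℕ → Prop := fun i => i = 0 ∨ (i < n ∧ AA 0 x (i - 1)) with hw
  set F : ℕ → Prop := fun k => ∀ i, i < k → w i with hF
  set N : ℕ → Prop := fun k => ∀ i, k ≤ i → ¬ (w i ∧ w (i + 1)) with hN
  have ht := tele w F N (fun _ => Iff.rfl) (fun _ => Iff.rfl) (Or.inl rfl) (n + 1)
  have hnF : ∀ k, n < k → ¬ F k := by
    intro k hk h
    rcases h n hk with h | h <;> omega
  have hPP : ∀ k, k ≤ n → (PP n k x ↔ F k ∧ N (k + 1)) := by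
    intro k hk
    refine and_congr ?_ ?_
    · constructor
      · intro h i hi
        rcases Nat.eq_zero_or_pos i with h0 | h0
        · exact Or.inl h0
        · exact Or.inr ⟨by omega, h (i - 1) (by omega)⟩
      · intro h i hi
        rcases h (i + 1) hi with h | h
        · omega
        · exact h.2
    · have hA : ∀ i, AA k (fun i => x (k + i)) i ↔ AA 0 x (k + i) := by
        intro i
        unfold AA
        rw [show (i + k) % 2 = (k + i + 0) % 2 by omega]
        rfl
      constructor
      · rintro h i hi ⟨h1, h2⟩
        rcases h1 with h1 | h1
        · omega
        rcases h2 with h2 | h2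
        · omega
        apply h (i - 1 - k) (by omega)
        rw [hA, hA, show k + (i - 1 - k) = i - 1 by omega,
          show k + (i - 1 - k + 1) = i + 1 - 1 by omega]
        exact ⟨h1.2, h2.2⟩
      · rintro h i hi ⟨h1, h2⟩
        rw [hA] at h1 h2
        exact h (k + i + 1) (by omega) ⟨Or.inr ⟨by omega, h1⟩, Or.inr ⟨by omega, h2⟩⟩
  rw [if_neg (fun h => hnF _ (by omega) h.1), neg_zero] at ht
  refine Eq.trans ?_ ht
  rw [← Finset.sum_subset (s₁ := Finset.range (n + 1)) (s₂ := Finset.range (3 * (n + 1)))]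
  · refine Finset.sum_congr rfl fun k hk => ?_
    have h := hPP k (by simpa [Nat.lt_succ_iff] using hk)
    by_cases hc : PP n k x
    · rw [if_pos hc, if_pos (h.1 hc)]
    · rw [if_neg hc, if_neg (fun h' => hc (h.2 h'))]
  · intro i hi
    simp only [Finset.mem_range] at *
    omega
  · intro i _ hi
    simp only [Finset.mem_range] at hi
    rw [if_neg (fun h : F i ∧ N (i + 1) => hnF i (by omega) h.1), mul_zero]

/-- in `ℚ⟦X⟧`, letting `A` have coefficient of `Xⁿ` equal to `Eₙ/n!` if
`n ≡ 0 (mod 3)`, `−Eₙ/n!` if `n ≡ 1 (mod 3)`, and `0` if `n ≡ 2 (mod 3)`, we have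
`A · Σₙ f(n)·Xⁿ/n! = 1`. -/
theorem statement7 :
    (PowerSeries.mk (fun n : ℕ =>
        if n % 3 = 0 then (eulerNum n : ℚ) / n.factorial
        else if n % 3 = 1 then -((eulerNum n : ℚ) / n.factorial)
        else 0)) *
      (PowerSeries.mk (fun n : ℕ => (fCount n : ℚ) / n.factorial)) = 1 := by
  classical
  ext n
  rw [PowerSeries.coeff_mul, PowerSeries.coeff_one]
  simp only [PowerSeries.coeff_mk]
  have key : ∀ p ∈ Finset.HasAntidiagonal.antidiagonal n,
      (if p.1 % 3 = 0 then (eulerNum p.1 : ℚ) / p.1.factorial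
        else if p.1 % 3 = 1 then -((eulerNum p.1 : ℚ) / p.1.factorial) else 0) *
        ((fCount p.2 : ℚ) / p.2.factorial) =
      (if p.1 % 3 = 0 then (1 : ℚ) else if p.1 % 3 = 1 then -1 else 0) *
        ((∑ σ : Equiv.Perm (Fin n), if PP n p.1 (PermSeq σ) then (1 : ℚ) else 0)
          / n.factorial) := by
    rintro ⟨k, m⟩ hp
    rw [Finset.HasAntidiagonal.mem_antidiagonal] at hp
    simp only at hp
    subst hp
    have h := PP_card k m
    rw [Nat.card_eq_fintype_card, Fintype.card_subtype] at h
    rw [Finset.sum_boole, h]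
    simp only
    split_ifs <;> ring
  rw [Finset.sum_congr rfl key]
  rw [Finset.Nat.sum_antidiagonal_eq_sum_range_succ_mk]
  simp only
  rcases Nat.eq_zero_or_pos n with rfl | hn
  · simp [PP, AllA, NoAA]
  · rw [if_neg (by omega)]
    simp only [← mul_div_assoc]
    rw [← Finset.sum_div]
    simp only [Finset.mul_sum]
    rw [Finset.sum_comm, Finset.sum_eq_zero, zero_div]
    intro σ _
    exact PP_sum n hn (PermSeq σ)
end

section
/- Fix an integer m ≥ 2. Let bₘ(n) be the number of permutations of [n] all of whose increasing runs have length less than m (equivalently, there is no index i with πᵢ < πᵢ₊₁ < ⋯ < πᵢ₊ₘ₋₁); bₘ(0)=1. In ℚ⟦X⟧, let Bₘ be the power series whose coefficient of Xⁿ is 1/n! if n ≡ 0 (mod m), −1/n! if n ≡ 1 (mod m), and 0 otherwise. Then Bₘ · (Σ_{n=0}^∞ bₘ(n)·Xⁿ/n!) = 1. -/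
/-- `bCount m n` is the number of permutations of `[n]` all of whose increasing runs
have length less than `m`: among any `m − 1` consecutive indices in `{1, …, n−1}`,
at least one is a descent. -/
noncomputable def bCount (m n : ℕ) : ℕ :=
  Nat.card {σ : Equiv.Perm (Fin n) //
    ∀ i, 1 ≤ i → i + m ≤ n + 1 → ∃ j ∈ Finset.Ico i (i + m - 1), IsDescent σ j}

/-- coefficient sign -/
def cSgn (m n : ℕ) : ℚ := if n % m = 0 then 1 else if n % m = 1 then -1 else 0

theorem cSgn_range (m : ℕ) (N : ℕ) (hN : 2 ≤ N) (hNm : N ≤ m) :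
    ∑ k ∈ Finset.range N, cSgn m k = 0 := by
  induction N, hN using Nat.le_induction with
  | base =>
    have h1 : 1 % m = 1 := Nat.mod_eq_of_lt (by omega)
    simp [Finset.sum_range_succ, cSgn, h1]
  | succ N h ih =>
    have h1 : N % m = N := Nat.mod_eq_of_lt (by omega)
    rw [Finset.sum_range_succ, ih (by omega)]
    simp only [cSgn, h1]
    rw [if_neg (by omega), if_neg (by omega)]
    simp

theorem cSgn_window (m : ℕ) (hm : 2 ≤ m) (a : ℕ) :
    ∑ k ∈ Finset.Ico a (a + m), cSgn m k = 0 := by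
  induction a with
  | zero => simpa using cSgn_range m m hm le_rfl
  | succ a ih =>
    rw [Finset.sum_eq_sum_Ico_succ_bot (by omega)] at ih
    rw [show a + 1 + m = (a + m) + 1 by ring, Finset.sum_Ico_succ_top (by omega)]
    have : cSgn m (a + m) = cSgn m a := by simp [cSgn]
    rw [this]; linarith

theorem cSgn_Ico (m : ℕ) (hm : 2 ≤ m) (L : ℕ) (hL : 1 ≤ L) :
    ∑ k ∈ Finset.Ico (L + 1 - m) (L + 1), cSgn m k = 0 := by
  by_cases h : m ≤ L + 1
  · have := cSgn_window m hm (L + 1 - m)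
    rwa [Nat.sub_add_cancel h] at this
  · rw [Nat.sub_eq_zero_of_le (by omega)]
    simpa using cSgn_range m (L + 1) (by omega) (by omega)

/-- First `k` entries increasing, the part after position `k` has short runs. -/
def PrefGood (m n k : ℕ) (D : ℕ → Prop) : Prop :=
  (∀ j, 1 ≤ j → j < k → ¬ D j) ∧
  ∀ i, k + 1 ≤ i → i + m ≤ n + 1 → ∃ j ∈ Finset.Ico i (i + m - 1), D j

open Classical in
theorem pointwise (m n : ℕ) (hm : 2 ≤ m) (hn : 1 ≤ n) (D : ℕ → Prop) :
    ∑ k ∈ Finset.range (n + 1), (if PrefGood m n k D then cSgn m k else 0) = 0 := by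
  have hex : ∃ j, 1 ≤ j ∧ (D j ∨ j = n) := ⟨n, hn, Or.inr rfl⟩
  obtain ⟨L, ⟨hL1, hL2⟩, hLmin⟩ : ∃ L, (1 ≤ L ∧ (D L ∨ L = n)) ∧
      ∀ j, j < L → ¬ (1 ≤ j ∧ (D j ∨ j = n)) :=
    ⟨Nat.find hex, Nat.find_spec hex, fun j hj => Nat.find_min hex hj⟩
  have hLn : L ≤ n := by
    by_contra h
    exact hLmin n (by omega) ⟨hn, Or.inr rfl⟩
  by_cases R : ∀ i, L + 1 ≤ i → i + m ≤ n + 1 → ∃ j ∈ Finset.Ico i (i + m - 1), D j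
  · rw [← Finset.sum_filter, ← cSgn_Ico m hm L hL1]
    apply Finset.sum_congr _ (fun _ _ => rfl)
    ext k
    rw [Finset.mem_filter, Finset.mem_range, Finset.mem_Ico, PrefGood]
    constructor
    · rintro ⟨hk, h1, h2⟩
      have hkL : k ≤ L := by
        by_contra hc
        rcases hL2 with h | h
        · exact h1 L hL1 (by omega) h
        · omega
      refine ⟨?_, by omega⟩
      by_contra hc
      obtain ⟨j, hj, hD⟩ := h2 (k + 1) le_rfl (by omega)
      rw [Finset.mem_Ico] at hj
      exact hLmin j (by omega) ⟨by omega, Or.inl hD⟩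
    · rintro ⟨h1, h2⟩
      refine ⟨by omega, fun j hj hjk hD => hLmin j (by omega) ⟨hj, Or.inl hD⟩, ?_⟩
      intro i hi him
      by_cases hiL : L + 1 ≤ i
      · exact R i hiL him
      · rcases hL2 with h | h
        · exact ⟨L, Finset.mem_Ico.2 ⟨by omega, by omega⟩, h⟩
        · omega
  · apply Finset.sum_eq_zero
    intro k hk
    rw [if_neg]
    rintro ⟨h1, h2⟩
    apply R
    intro i hi him
    refine h2 i ?_ him
    have hkL : k ≤ L := by
      by_contra hc
      rcases hL2 with h | h
      · exact h1 L hL1 (by omega) h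
      · rw [Finset.mem_range] at hk; omega
    omega

theorem isDescent_iff {n : ℕ} (σ : Equiv.Perm (Fin n)) (i : ℕ) (h1 : 1 ≤ i) (h2 : i < n) :
    IsDescent σ i ↔ σ ⟨i, h2⟩ < σ ⟨i - 1, by omega⟩ := by
  unfold IsDescent permEnt
  rw [dif_pos (by omega), dif_pos (by omega)]
  rw [Fin.lt_def]
  simp only [h1, h2, true_and, Nat.add_lt_add_iff_right, Nat.add_sub_cancel]

/-- Glue a set and a permutation of the complement. -/
def glue {k l : ℕ} (s : {s : Finset (Fin (k + l)) // s.card = k}) (τ : Equiv.Perm (Fin l)) :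
    Equiv.Perm (Fin (k + l)) :=
  finSumFinEquiv.symm.trans ((Equiv.sumCongr (Equiv.refl _) τ).trans
    (finSumEquivOfFinset s.2 (by rw [Finset.card_compl, s.2]; simp)))

theorem glue_left {k l : ℕ} (s : {s : Finset (Fin (k + l)) // s.card = k})
    (τ : Equiv.Perm (Fin l)) (i : Fin k) :
    glue s τ (Fin.castAdd l i) = s.1.orderEmbOfFin s.2 i := by
  simp [glue]

theorem glue_right {k l : ℕ} (s : {s : Finset (Fin (k + l)) // s.card = k})
    (τ : Equiv.Perm (Fin l)) (i : Fin l) :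
    glue s τ (Fin.natAdd k i) =
      s.1ᶜ.orderEmbOfFin (by rw [Finset.card_compl, s.2]; simp) (τ i) := by
  simp [glue]

theorem glue_desc_left {k l : ℕ} (s : {s : Finset (Fin (k + l)) // s.card = k})
    (τ : Equiv.Perm (Fin l)) (j : ℕ) (h1 : 1 ≤ j) (h2 : j < k) : ¬ IsDescent (glue s τ) j := by
  rw [isDescent_iff _ _ h1 (by omega)]
  have e1 := glue_left s τ ⟨j, h2⟩
  have e2 := glue_left s τ ⟨j - 1, by omega⟩
  simp only [Fin.castAdd_mk] at e1 e2
  rw [e1, e2, OrderEmbedding.lt_iff_lt, Fin.lt_def]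
  simp

theorem glue_desc_right {k l : ℕ} (s : {s : Finset (Fin (k + l)) // s.card = k})
    (τ : Equiv.Perm (Fin l)) (j : ℕ) (h1 : 1 ≤ j) :
    IsDescent (glue s τ) (k + j) ↔ IsDescent τ j := by
  by_cases h2 : j < l
  · rw [isDescent_iff _ _ (by omega) (by omega), isDescent_iff _ _ h1 h2]
    have e1 := glue_right s τ ⟨j, h2⟩
    have e2 := glue_right s τ ⟨j - 1, by omega⟩
    simp only [Fin.natAdd_mk, ← Nat.add_sub_assoc h1] at e1 e2
    rw [e1, e2, OrderEmbedding.lt_iff_lt]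
  · constructor
    · intro h; have := h.2.1; omega
    · intro h; have := h.2.1; omega

theorem glue_good (m : ℕ) {k l : ℕ} (s : {s : Finset (Fin (k + l)) // s.card = k})
    (τ : Equiv.Perm (Fin l)) :
    PrefGood m (k + l) k (IsDescent (glue s τ)) ↔
      ∀ i, 1 ≤ i → i + m ≤ l + 1 → ∃ j ∈ Finset.Ico i (i + m - 1), IsDescent τ j := by
  constructor
  · rintro ⟨-, h⟩ i hi him
    obtain ⟨j, hj, hD⟩ := h (k + i) (by omega) (by omega)
    rw [Finset.mem_Ico] at hj
    refine ⟨j - k, Finset.mem_Ico.2 ⟨by omega, by omega⟩, ?_⟩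
    rw [← glue_desc_right s τ _ (by omega)]
    rwa [show k + (j - k) = j by omega]
  · intro h
    refine ⟨glue_desc_left s τ, fun i hi him => ?_⟩
    obtain ⟨j, hj, hD⟩ := h (i - k) (by omega) (by omega)
    rw [Finset.mem_Ico] at hj
    exact ⟨k + j, Finset.mem_Ico.2 ⟨by omega, by omega⟩, (glue_desc_right s τ _ (by omega)).2 hD⟩

theorem glue_image {k l : ℕ} (s : {s : Finset (Fin (k + l)) // s.card = k})
    (τ : Equiv.Perm (Fin l)) :
    Finset.univ.image (fun i : Fin k => glue s τ (Fin.castAdd l i)) = s.1 := by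
  simp only [glue_left]
  apply Finset.coe_injective
  simp

theorem glue_inj {k l : ℕ} (s s' : {s : Finset (Fin (k + l)) // s.card = k})
    (τ τ' : Equiv.Perm (Fin l)) (h : glue s τ = glue s' τ') : s = s' ∧ τ = τ' := by
  have hs : s = s' := by
    apply Subtype.ext
    rw [← glue_image s τ, h, glue_image]
  subst hs
  refine ⟨rfl, ?_⟩
  ext i : 1
  have := glue_right s τ i
  rw [h, glue_right] at this
  exact ((OrderEmbedding.strictMono _).injective this).symm

theorem glue_surj {k l : ℕ} (σ : Equiv.Perm (Fin (k + l)))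
    (h : ∀ j, 1 ≤ j → j < k → ¬ IsDescent σ j) : ∃ s τ, glue s τ = σ := by
  have hmono : StrictMono (fun i : Fin k => σ (Fin.castAdd l i)) := by
    cases k with
    | zero => exact fun i => i.elim0
    | succ k =>
      rw [Fin.strictMono_iff_lt_succ]
      intro i
      have := h (i + 1) (by omega) (by omega)
      rw [isDescent_iff _ _ (by omega) (by omega), not_lt] at this
      refine lt_of_le_of_ne this ?_
      intro hc
      have := σ.injective hc
      simp [Fin.ext_iff] at this
  let s : {s : Finset (Fin (k + l)) // s.card = k} :=
    ⟨Finset.univ.image (fun i : Fin k => σ (Fin.castAdd l i)), by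
      rw [Finset.card_image_of_injective _ hmono.injective]; simp⟩
  have hs : (fun i : Fin k => σ (Fin.castAdd l i)) = s.1.orderEmbOfFin s.2 :=
    Finset.orderEmbOfFin_unique s.2 (fun i => by simp [s]) hmono
  let g := glue s (Equiv.refl _)
  let ρ : Equiv.Perm (Fin k ⊕ Fin l) := (finSumFinEquiv.trans (σ.trans g.symm)).trans
    finSumFinEquiv.symm
  have hρ : ∀ i, ρ (Sum.inl i) = Sum.inl i := by
    intro i
    have h1 : σ (Fin.castAdd l i) = g (Fin.castAdd l i) := by
      rw [glue_left]; exact congrFun hs i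
    simp [ρ, h1]
  have hmem : ρ ∈ (Equiv.Perm.sumCongrHom (Fin k) (Fin l)).range := by
    apply Equiv.Perm.mem_sumCongrHom_range_of_perm_mapsTo_inl
    rintro _ ⟨i, rfl⟩
    exact ⟨i, (hρ i).symm⟩
  obtain ⟨⟨a, τ⟩, hτ⟩ := hmem
  refine ⟨s, τ, ?_⟩
  ext x : 1
  refine Fin.addCases (fun i => ?_) (fun i => ?_) x
  · rw [glue_left]; exact (congrFun hs i).symm
  · have h1 : ρ (Sum.inr i) = Sum.inr (τ i) := by rw [← hτ]; simp
    have h2 : g.symm (σ (Fin.natAdd k i)) = Fin.natAdd k (τ i) := by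
      have := congrArg finSumFinEquiv h1
      simpa [ρ] using this
    rw [Equiv.symm_apply_eq] at h2
    rw [h2, glue_right, glue_right]
    rfl

theorem count_glue (m k l n : ℕ) (h : k + l = n) :
    n.choose k * bCount m l =
      Nat.card {σ : Equiv.Perm (Fin n) // PrefGood m n k (IsDescent σ)} := by
  subst h
  have h1 : (k + l).choose k = Nat.card {s : Finset (Fin (k + l)) // s.card = k} := by
    rw [Nat.card_eq_fintype_card, Fintype.card_finset_len, Fintype.card_fin]
  rw [h1, bCount, ← Nat.card_prod]
  refine Nat.card_congr (Equiv.ofBijective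
    (fun p => ⟨glue p.1 p.2.1, (glue_good m p.1 p.2.1).2 p.2.2⟩) ⟨?_, ?_⟩)
  · rintro ⟨s, τ⟩ ⟨s', τ'⟩ h
    obtain ⟨h1, h2⟩ := glue_inj _ _ _ _ (congrArg Subtype.val h)
    exact Prod.ext h1 (Subtype.ext h2)
  · rintro ⟨σ, hσ⟩
    obtain ⟨s, τ, rfl⟩ := glue_surj σ hσ.1
    exact ⟨(s, ⟨τ, (glue_good m s τ).1 hσ⟩), rfl⟩

theorem main_sum (m n : ℕ) (hm : 2 ≤ m) (hn : 1 ≤ n) :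
    ∑ p ∈ Finset.HasAntidiagonal.antidiagonal n, cSgn m p.1 * ((n.choose p.1 * bCount m p.2 : ℕ) : ℚ) = 0 := by
  classical
  have h1 : ∀ p ∈ Finset.HasAntidiagonal.antidiagonal n, cSgn m p.1 * ((n.choose p.1 * bCount m p.2 : ℕ) : ℚ) =
      ∑ σ : Equiv.Perm (Fin n), if PrefGood m n p.1 (IsDescent σ) then cSgn m p.1 else 0 := by
    intro p hp
    rw [count_glue m p.1 p.2 n (Finset.HasAntidiagonal.mem_antidiagonal.1 hp), Nat.card_eq_fintype_card,
      Fintype.card_subtype, ← Finset.sum_filter, Finset.sum_const, nsmul_eq_mul, mul_comm]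
  rw [Finset.sum_congr rfl h1, Finset.sum_comm]
  apply Finset.sum_eq_zero
  intro σ _
  rw [Finset.Nat.sum_antidiagonal_eq_sum_range_succ
    (fun a _ => if PrefGood m n a (IsDescent σ) then cSgn m a else 0)]
  exact pointwise m n hm hn _

theorem bCount_zero (m : ℕ) (hm : 2 ≤ m) : bCount m 0 = 1 := by
  unfold bCount
  rw [Nat.card_eq_one_iff_unique]
  exact ⟨inferInstance, ⟨⟨Equiv.refl _, fun i h1 h2 => by omega⟩⟩⟩

/-- for `m ≥ 2`, in `ℚ⟦X⟧`, letting `Bₘ` have coefficient of `Xⁿ` equal to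
`1/n!` if `n ≡ 0 (mod m)`, `−1/n!` if `n ≡ 1 (mod m)`, and `0` otherwise, we have
`Bₘ · Σₙ bₘ(n)·Xⁿ/n! = 1`. -/
theorem statement9 (m : ℕ) (hm : 2 ≤ m) :
    (PowerSeries.mk (fun n : ℕ =>
        if n % m = 0 then (1 : ℚ) / n.factorial
        else if n % m = 1 then -((1 : ℚ) / n.factorial)
        else 0)) *
      (PowerSeries.mk (fun n : ℕ => (bCount m n : ℚ) / n.factorial)) = 1 := by
  ext n
  rw [PowerSeries.coeff_mul]
  simp only [PowerSeries.coeff_mk, PowerSeries.coeff_one]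
  rcases Nat.eq_zero_or_pos n with rfl | hn
  · simp [bCount_zero m hm]
  rw [if_neg (by omega)]
  have h := main_sum m n hm hn
  have h2 := congrArg (fun x : ℚ => x / n.factorial) h
  simp only [Finset.sum_div, zero_div] at h2
  refine Eq.trans (Finset.sum_congr rfl ?_) h2
  rintro ⟨k, l⟩ hp
  rw [Finset.HasAntidiagonal.mem_antidiagonal] at hp
  simp only at hp ⊢
  subst hp
  have hc : (((k + l).choose k : ℕ) : ℚ) * k.factorial * l.factorial = (k + l).factorial := by
    have := Nat.choose_mul_factorial_mul_factorial (Nat.le_add_right k l)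
    rw [Nat.add_sub_cancel_left] at this
    exact_mod_cast this
  have e1 : (if k % m = 0 then (1 : ℚ) / k.factorial
        else if k % m = 1 then -((1 : ℚ) / k.factorial) else 0) = cSgn m k / k.factorial := by
    unfold cSgn
    split_ifs <;> ring
  have hk : (k.factorial : ℚ) ≠ 0 := by exact_mod_cast Nat.factorial_ne_zero k
  have hl : (l.factorial : ℚ) ≠ 0 := by exact_mod_cast Nat.factorial_ne_zero l
  have hch : (((k + l).choose k : ℕ) : ℚ) ≠ 0 := by
    exact_mod_cast (Nat.choose_pos (Nat.le_add_right k l)).ne'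
  rw [e1, ← hc]
  push_cast
  field_simp
end
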